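/- arXiv:2602.06894 — 2 statements merged into one kernel-verified Lean document; each statement's English description precedes it below -/
import Mathlib

section
/- Fix a cubic number field K. The number of pairs (a, b) ∈ ℤ² such that the polynomial f(x) = x³ + a x² + b x + 1 is irreducible over ℚ, the order ℤ[θ] generated by a root θ of f is the full ring of integers of the field ℚ[x]/(f(x)), and ℚ[x]/(f(x)) is isomorphic (as a field) to K, is at most 60. -/
open Polynomial

/-- The cubic polynomial `x³ + a x² + b x + 1` with integer coefficients `a`, `b`,
viewed over `ℚ`. -/
noncomputable def cubicPoly (a b : ℤ) : ℚ[X] :=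
  X ^ 3 + C (a : ℚ) * X ^ 2 + C (b : ℚ) * X + 1

/-- A cubic polynomial `f` is maximal if the order `ℤ[θ]` generated by the root
`θ` of `f` in `ℚ[x]/(f)` is the full ring of integers (the integral closure of `ℤ`)
of `ℚ[x]/(f)`. -/
def IsMaximalPoly (f : ℚ[X]) : Prop :=
  Algebra.adjoin ℤ {AdjoinRoot.root f} = integralClosure ℤ (AdjoinRoot f)

/-- discriminant of `x³ + a x² + b x + 1` -/
def dsc (a b : ℤ) : ℤ := a^2*b^2 - 4*a^3 - 4*b^3 + 18*a*b - 27

/-- the binary cubic form attached to `(a, b)` -/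
def cform (a b x y : ℤ) : ℤ := x^3 + a*x^2*y + b*x*y^2 + y^3

/-- the form of `(a, b)` is obtained from the form of `(a0, b0)` by the
unimodular substitution with rows `(x, y)`, `(z, w)`. -/
def FRel (a0 b0 x y z w a b : ℤ) : Prop :=
  (x*w - y*z)^2 = 1 ∧ cform a0 b0 x y = 1 ∧ cform a0 b0 z w = 1 ∧
  a = 3*x^2*z + a0*(x^2*w + 2*x*y*z) + b0*(2*x*y*w + y^2*z) + 3*y^2*w ∧
  b = 3*z^2*x + a0*(z^2*y + 2*z*w*x) + b0*(2*z*w*y + w^2*x) + 3*w^2*y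

lemma FRel.swap {a0 b0 x y z w a b : ℤ} (h : FRel a0 b0 x y z w a b) :
    FRel a0 b0 z w x y b a := by
  obtain ⟨h1, h2, h3, h4, h5⟩ := h
  refine ⟨?_, h3, h2, h5, h4⟩
  rw [← h1]; ring

lemma FRel.hess {a0 b0 x y z w a b : ℤ} (h : FRel a0 b0 x y z w a b) :
    (a0^2 - 3*b0)*x^2 + (a0*b0 - 9)*x*y + (b0^2 - 3*a0)*y^2 = a^2 - 3*b := by
  obtain ⟨h1, h2, h3, h4, h5⟩ := h
  have key : a^2 - 3*cform a0 b0 x y*b = (x*w - y*z)^2 *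
      ((a0^2 - 3*b0)*x^2 + (a0*b0 - 9)*x*y + (b0^2 - 3*a0)*y^2) := by
    rw [h4, h5, cform]; ring
  rw [h1, h2] at key
  linarith

lemma FRel.dsc {a0 b0 x y z w a b : ℤ} (h : FRel a0 b0 x y z w a b) :
    dsc a b = dsc a0 b0 := by
  obtain ⟨h1, h2, h3, h4, h5⟩ := h
  have key : a^2*b^2 - 4*a^3*cform a0 b0 z w - 4*b^3*cform a0 b0 x y
      + 18*a*b*cform a0 b0 x y*cform a0 b0 z w
      - 27*(cform a0 b0 x y)^2*(cform a0 b0 z w)^2 = ((x*w - y*z)^2)^3 * _root_.dsc a0 b0 := by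
    rw [h4, h5, cform, cform, _root_.dsc]; ring
  rw [h1, h2, h3] at key
  rw [_root_.dsc]
  linarith

lemma FRel.same {a0 b0 x y z w a b x' y' z' w' a' b' : ℤ} (h : FRel a0 b0 x y z w a b)
    (h' : FRel a0 b0 x' y' z' w' a' b') (hd : x*y' = x'*y) : x = x' ∧ y = y' := by
  obtain ⟨h1, h2, h3, h4, h5⟩ := h
  obtain ⟨h1', h2', h3', h4', h5'⟩ := h'
  set e := x*w - y*z with he
  set k := (x'*w - y'*z)*e with hk
  have hx : x' = x*k := by
    have : x' * e^2 = x*k := by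
      rw [hk, he]; linear_combination ((x*w-y*z)*z) * hd
    rw [h1] at this; linarith
  have hy : y' = y*k := by
    have : y' * e^2 = y*k := by
      rw [hk, he]; linear_combination (-(x*w-y*z)*w) * hd * (-1)
    rw [h1] at this; linarith
  have hk3 : k^3 = 1 := by
    have : cform a0 b0 x' y' = k^3 * cform a0 b0 x y := by
      rw [hx, hy, cform, cform]; ring
    rw [h2, h2'] at this; linarith
  have hk1 : k = 1 := by
    have : (k - 1)*(k^2+k+1) = 0 := by linear_combination hk3
    rcases mul_eq_zero.1 this with h | h
    · linarith
    · exfalso; clear_value k; clear * - h; nlinarith [sq_nonneg (k+1), sq_nonneg k]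
  rw [hx, hy, hk1]; simp

lemma six (P D : ℤ) : {q : ℤ × ℤ | q.1^2 - 3*q.2 = P ∧ dsc q.1 q.2 = D}.encard ≤ 6 := by
  set f : ℤ[X] := (X^3 - C (3*P) * X - C 27)^2 - C (4*P^3 - 27*D) with hf
  have h3 : (X^3 - C (3*P) * X - C 27 : ℤ[X]).natDegree = 3 := by compute_degree!
  have hdeg : f.natDegree ≤ 6 := by
    rw [hf]; compute_degree
  have hc : f.coeff 6 = 1 := by
    rw [hf]; compute_degree!
  have hf0 : f ≠ 0 := by
    intro h; rw [h] at hc; simp at hc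
  have hsub : Prod.fst '' {q : ℤ × ℤ | q.1^2 - 3*q.2 = P ∧ dsc q.1 q.2 = D} ⊆
      (f.roots.toFinset : Set ℤ) := by
    rintro _ ⟨⟨a, b⟩, ⟨h1, h2⟩, rfl⟩
    simp only [Finset.mem_coe, Multiset.mem_toFinset, mem_roots hf0, IsRoot.def]
    simp only at h1 h2
    rw [hf, ← h1, ← h2, dsc]
    simp
    ring
  have hinj : Set.InjOn Prod.fst {q : ℤ × ℤ | q.1^2 - 3*q.2 = P ∧ dsc q.1 q.2 = D} := by
    rintro ⟨a, b⟩ ⟨h1, _⟩ ⟨a', b'⟩ ⟨h1', _⟩ h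
    simp only at h h1 h1'
    subst h
    have : b = b' := by linarith
    rw [this]
  rw [← hinj.encard_image]
  refine (Set.encard_le_encard hsub).trans ?_
  rw [Set.encard_coe_eq_coe_finsetCard]
  have : f.roots.toFinset.card ≤ 6 :=
    (Multiset.toFinset_card_le _).trans ((card_roots' f).trans hdeg)
  exact_mod_cast this

/-- vectors that are short for a quadratic form -/
def smallSet (a0 b0 : ℤ) (A B C d : ℝ) : Set (ℤ × ℤ) :=
  {q | ∃ x y z w : ℤ, FRel a0 b0 x y z w q.1 q.2 ∧
    (A*x^2 + B*x*y + C*y^2)^2 < 9*d/4}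

lemma small_aux (a0 b0 : ℤ) (A B C d : ℝ) (hd : 4*A*C - B^2 = d)
    (l m : ℤ) (hlm : ∀ x y x' y' : ℤ, 3 ∣ l*x+m*y → 3 ∣ l*x'+m*y' → 3 ∣ x*y'-x'*y) :
    {q : ℤ × ℤ | ∃ x y z w : ℤ, FRel a0 b0 x y z w q.1 q.2 ∧
    (A*x^2 + B*x*y + C*y^2)^2 < 9*d/4 ∧ 3 ∣ l*x+m*y}.encard ≤ 6 := by
  rcases Set.eq_empty_or_nonempty {q : ℤ × ℤ | ∃ x y z w : ℤ, FRel a0 b0 x y z w q.1 q.2 ∧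
    (A*x^2 + B*x*y + C*y^2)^2 < 9*d/4 ∧ 3 ∣ l*x+m*y} with h | ⟨q0, x, y, z, w, h, hs, h3⟩
  · rw [h]; simp
  refine (Set.encard_le_encard ?_).trans (six (q0.1^2 - 3*q0.2) (dsc a0 b0))
  rintro q ⟨x', y', z', w', h', hs', h3'⟩
  refine ⟨?_, h'.dsc⟩
  suffices hh : x*y' = x'*y by
    obtain ⟨rfl, rfl⟩ := h.same h' hh
    rw [← h.hess, ← h'.hess]
  by_contra hne
  obtain ⟨k, hk⟩ := hlm x y x' y' h3 h3'
  have hk0 : k ≠ 0 := by rintro rfl; apply hne; linarith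
  have hk1 : 1 ≤ k^2 := by
    have : 0 < k^2 := by positivity
    linarith
  have hdet : (9:ℝ) ≤ ((x:ℝ)*y' - x'*y)^2 := by
    have : (9:ℤ) ≤ (x*y' - x'*y)^2 := by rw [hk]; nlinarith
    exact_mod_cast this
  have hdpos : 0 < d := by nlinarith [sq_nonneg (A*x^2 + B*x*y + C*y^2)]
  have hid : 4*(A*x^2 + B*x*y + C*y^2)*(A*x'^2 + B*x'*y' + C*y'^2) =
     (2*A*x*x' + B*(x*y'+x'*y) + 2*C*y*y')^2 + d*((x:ℝ)*y' - x'*y)^2 := by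
    rw [← hd]; ring
  have hge : 9*d ≤ 4*((A*x^2 + B*x*y + C*y^2)*(A*x'^2 + B*x'*y' + C*y'^2)) := by
    nlinarith [sq_nonneg (2*A*x*x' + B*(x*y'+x'*y) + 2*C*y*y')]
  nlinarith [sq_nonneg ((A*x^2 + B*x*y + C*y^2)-(A*x'^2 + B*x'*y' + C*y'^2))]

lemma small_card (a0 b0 : ℤ) (A B C d : ℝ) (hd : 4*A*C - B^2 = d) :
    (smallSet a0 b0 A B C d).encard ≤ 24 := by
  have h1 := small_aux a0 b0 A B C d hd 1 0 (by
    intro x y x' y' ⟨k, hk⟩ ⟨k', hk'⟩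
    exact ⟨k*y' - k'*y, by linear_combination y' * hk - y * hk'⟩)
  have h2 := small_aux a0 b0 A B C d hd 0 1 (by
    intro x y x' y' ⟨k, hk⟩ ⟨k', hk'⟩
    exact ⟨x*k' - x'*k, by linear_combination x * hk' - x' * hk⟩)
  have h3 := small_aux a0 b0 A B C d hd 1 1 (by
    intro x y x' y' ⟨k, hk⟩ ⟨k', hk'⟩
    exact ⟨k*y' - k'*y, by linear_combination y' * hk - y * hk'⟩)
  have h4 := small_aux a0 b0 A B C d hd 1 (-1) (by
    intro x y x' y' ⟨k, hk⟩ ⟨k', hk'⟩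
    exact ⟨k*y' - k'*y, by linear_combination y' * hk - y * hk'⟩)
  set S1 : ℤ → ℤ → Set (ℤ × ℤ) := fun l m => {q : ℤ × ℤ | ∃ x y z w : ℤ,
    FRel a0 b0 x y z w q.1 q.2 ∧
    (A*x^2 + B*x*y + C*y^2)^2 < 9*d/4 ∧ 3 ∣ l*x+m*y} with hS1
  change (S1 1 0).encard ≤ 6 at h1
  change (S1 0 1).encard ≤ 6 at h2
  change (S1 1 1).encard ≤ 6 at h3
  change (S1 1 (-1)).encard ≤ 6 at h4
  have hsub : smallSet a0 b0 A B C d ⊆ S1 1 0 ∪ S1 0 1 ∪ S1 1 1 ∪ S1 1 (-1) := by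
    rintro q ⟨x, y, z, w, h, hs⟩
    have : 3 ∣ 1*x+0*y ∨ 3 ∣ 0*x+1*y ∨ 3 ∣ 1*x+1*y ∨ 3 ∣ 1*x+(-1)*y := by
      simp only [one_mul, zero_mul, zero_add, add_zero, neg_mul]
      rcases (by omega : x % 3 = 0 ∨ x % 3 = 1 ∨ x % 3 = 2) with hx | hx | hx <;>
      rcases (by omega : y % 3 = 0 ∨ y % 3 = 1 ∨ y % 3 = 2) with hy | hy | hy <;> omega
    rcases this with hh | hh | hh | hh
    · exact Or.inl (Or.inl (Or.inl ⟨x, y, z, w, h, hs, hh⟩))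
    · exact Or.inl (Or.inl (Or.inr ⟨x, y, z, w, h, hs, hh⟩))
    · exact Or.inl (Or.inr ⟨x, y, z, w, h, hs, hh⟩)
    · exact Or.inr ⟨x, y, z, w, h, hs, hh⟩
  refine (Set.encard_le_encard hsub).trans ?_
  refine (Set.encard_union_le _ _).trans ?_
  refine (add_le_add_left ((Set.encard_union_le _ _).trans (add_le_add_left (Set.encard_union_le _ _) _)) _).trans ?_
  refine (add_le_add (add_le_add (add_le_add h1 h2) h3) h4).trans ?_
  norm_num

lemma excep (D : ℤ) : {q : ℤ × ℤ | q.1^2 = 4*q.2 ∧ dsc q.1 q.2 = D}.encard ≤ 1 := by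
  rw [Set.encard_le_one_iff]
  rintro ⟨a, b⟩ ⟨a', b'⟩ ⟨h1, h2⟩ ⟨h1', h2'⟩
  simp only [dsc] at h1 h2 h1' h2'
  have e1 : a^3 = 2*(D+27) := by
    linear_combination (2*b^2 - 8*a+a)*h1*0 + 2*h2 + (-2*b^2 + 9*a) * h1
  have e2 : a'^3 = 2*(D+27) := by
    linear_combination 2*h2' + (-2*b'^2 + 9*a') * h1'
  have : a = a' := (Odd.strictMono_pow (by decide : Odd 3)).injective (e1.trans e2.symm)
  subst this
  have : b = b' := by linarith
  rw [this]

lemma pos_box : ∀ b ∈ Finset.Icc (-32:ℤ) 32, ∀ a ∈ Finset.Icc (-36:ℤ) 36,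
    a ≠ b → a + b ≠ -2 → 0 < dsc a b → a^2 - 3*b ≤ b^2 - 3*a → a^2 ≠ 4*b →
    ¬ (a = -9 ∧ b = 20) → 4*(a^2-3*b)^2 < 27*dsc a b := by
  unfold dsc
  decide +kernel

lemma pos_big (a b c : ℤ) (hb : 32 < |b|) (hc : a^2 = 4*b + c) (hc1 : 1 ≤ c ∨ c ≤ -1)
    (hP : 0 < b + c) (hPR : b + c ≤ b^2 - 3*a)
    (hab : |a| ≤ |b| + 3) (hD : 0 < c*(b^2-4*a) + 2*a*b - 27) :
    4*(b+c)^2 < 27*(c*(b^2-4*a) + 2*a*b - 27) := by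
  rcases hc1 with hc1 | hc1
  · obtain ⟨B, hB⟩ : ∃ B, |b| = B := ⟨_, rfl⟩
    obtain ⟨n, hn⟩ : ∃ n, |a| = n := ⟨_, rfl⟩
    have hB2 : b^2 = B^2 := by rw [← hB, sq_abs]
    have hn2 : a^2 = n^2 := by rw [← hn, sq_abs]
    have hb1 : b ≤ B := hB ▸ le_abs_self b
    have hb2 : -b ≤ B := hB ▸ neg_le_abs b
    have ha1 : a ≤ n := hn ▸ le_abs_self a
    have ha2 : -a ≤ n := hn ▸ neg_le_abs a
    have hn0 : 0 ≤ n := hn ▸ abs_nonneg a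
    have hmul : -(n*B) ≤ a*b := by rw [← hB, ← hn, ← abs_mul]; exact neg_abs_le _
    rw [hB] at hb
    rw [hB, hn] at hab
    have hconc : 0 ≤ (c-1)*((b^2-b-3*a) - c) := mul_nonneg (by linarith) (by linarith)
    have hB33 : 33*B ≤ B^2 := by nlinarith
    -- lower bound
    have hlow : c*(23*B^2-96*n-4*B-4) - 4*B - 12*n - 54*(n*B) - 729 ≤ 
        27*(c*(b^2-4*a) + 2*a*b - 27) - 4*(b+c)^2 := by
      have e1 : c*(23*B^2-96*n-4*B-4) ≤ c*(23*b^2-96*a-4*b-4) :=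
        mul_le_mul_of_nonneg_left (by rw [hB2]; linarith) (by linarith)
      nlinarith
    clear hconc hmul hb1 hb2 ha1 ha2 hD hPR hP
    by_cases hs : 8*n ≤ 3*B
    · have hnB : 8*(n*B) ≤ 3*B^2 := by nlinarith
      have hco : 0 ≤ 23*B^2-96*n-4*B-4 := by linarith
      have e2 : 0 ≤ (c-1)*(23*B^2-96*n-4*B-4) := mul_nonneg (by linarith) hco
      linarith
    · push Not at hs
      have h8 : 9*B^2 ≤ 64*n^2 := by nlinarith
      have hbB : b ≤ B := hB ▸ le_abs_self b
      have hc16 : 16 ≤ c := by linarith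
      have hnB : n*B ≤ B^2 + 3*B := by nlinarith
      have hco : 0 ≤ 23*B^2-96*n-4*B-4 := by linarith
      have e2 : 0 ≤ (c-16)*(23*B^2-96*n-4*B-4) := mul_nonneg (by linarith) hco
      linarith
  · exfalso
    have hb0 : 0 < b := by linarith
    rw [abs_of_pos hb0] at hb
    have ha : 4*a ≤ b + 16 := by nlinarith [sq_nonneg (a-8)]
    have hc' : 0 ≤ b^2 - 4*a := by nlinarith
    have h1 : c*(b^2-4*a) ≤ -(b^2-4*a) := by nlinarith
    nlinarith

lemma pos_case (a b : ℤ) (h1 : a ≠ b) (h2 : a + b ≠ -2) (hD : 0 < dsc a b)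
    (hPR : a^2 - 3*b ≤ b^2 - 3*a) (hc : a^2 ≠ 4*b) (he : ¬ (a = -9 ∧ b = 20)) :
    4*(a^2-3*b)^2 < 27*dsc a b := by
  have hab : |a| ≤ |b| + 3 := by
    have h : |2*a+3| ≤ |2*b+3| := sq_le_sq.1 (by nlinarith)
    have e1 : |2*a| ≤ |2*a+3| + 3 := by
      have := abs_sub (2*a+3) 3
      simpa using this
    have e2 : |2*b+3| ≤ |2*b| + 3 := by
      have := abs_add_le (2*b) 3
      simpa using this
    rw [abs_mul] at e1 e2
    norm_num at e1 e2
    linarith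
  by_cases hb : |b| ≤ 32
  · have ha : |a| ≤ 36 := by linarith
    rw [abs_le] at ha hb
    exact pos_box b (Finset.mem_Icc.2 hb) a (Finset.mem_Icc.2 ha) h1 h2 hD hPR hc he
  · push Not at hb
    have hdc : dsc a b = (a^2-4*b)*(b^2-4*a) + 2*a*b - 27 := by rw [dsc]; ring
    have hP : 0 < a^2 - 3*b := by
      have : 4*(a^2-3*b)^3 = 27*dsc a b + (27 + a*(3*(a^2-3*b)-a^2))^2 := by rw [dsc]; ring
      have h3 : 0 < (a^2-3*b)^3 := by nlinarith [sq_nonneg (27 + a*(3*(a^2-3*b)-a^2))]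
      exact (Odd.pow_pos_iff (by decide)).1 h3
    have hc1 : 1 ≤ a^2-4*b ∨ a^2-4*b ≤ -1 := by
      rcases lt_trichotomy (a^2-4*b) 0 with h | h | h
      · right; linarith
      · exact absurd (by linarith) hc
      · left; linarith
    have := pos_big a b (a^2-4*b) hb (by ring) hc1 (by linarith) (by linarith) hab (hdc ▸ hD)
    rw [hdc]
    convert this using 3
    ring

lemma neg_box1 : ∀ a ∈ Finset.Icc (-5:ℤ) 5, ∀ b ∈ Finset.Icc (-5:ℤ) 5,
    a ≠ b → a + b ≠ -2 → dsc a b < 0 → dsc a b ≤ -23 := by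
  unfold dsc
  decide +kernel

lemma neg_box2 : ∀ a ∈ Finset.Icc (-1:ℤ) 36, ∀ b ∈ Finset.Icc (-13:ℤ) 13,
    a ≠ b → a + b ≠ -2 → dsc a b < 0 → b^2 ≠ 4*a → ¬ (a = 12 ∧ b = -7) → 
    (2*a+5)^2 ≤ 20*(-dsc a b) := by
  unfold dsc
  decide +kernel
set_option maxHeartbeats 1000000 in
lemma neg_case (a b : ℤ) (t m : ℝ) (ht : 1 ≤ t) (ha : (a:ℝ) = t + m/t) (hb : (b:ℝ) = m + 1/t)
    (hu : 0 < 4*t - m^2) (h1 : a ≠ b) (h2 : a + b ≠ -2) (hD : dsc a b < 0)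
    (hc : b^2 ≠ 4*a) (he : ¬ (a = 12 ∧ b = -7)) :
    ((4*t-m^2) + 2*(t - m/t + 1/t^2))^2 < 27*((4*t-m^2)*(t - m/t + 1/t^2)^2) := by
  have ht0 : t ≠ 0 := by linarith
  obtain ⟨τ, hτ⟩ : ∃ τ, 1/t = τ := ⟨_, rfl⟩
  have htτ : t*τ = 1 := by rw [← hτ]; field_simp
  have hτ0 : 0 < τ := by rw [← hτ]; positivity
  have hτ1 : τ ≤ 1 := by nlinarith
  obtain ⟨k, hk⟩ : ∃ k, m/t = k := ⟨_, rfl⟩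
  have hkm : k = m*τ := by rw [← hk, ← hτ]; field_simp
  have hm : m = k*t := by rw [← hk]; field_simp
  have hk2 : k^2 < 4*τ := by
    have : k^2 = m^2*τ^2 := by rw [hkm]; ring
    have h4 : 4*τ = 4*t*τ^2 := by linear_combination (-4*τ)*htτ
    rw [this, h4]
    have : 0 < τ^2 := by positivity
    nlinarith
  have hτ2 : 1/t^2 = τ^2 := by rw [← hτ]; field_simp
  rw [hk] at ha
  rw [hτ] at hb
  rw [hk, hτ2]
  obtain ⟨σ, hσ⟩ : ∃ σ, t - k + τ^2 = σ := ⟨_, rfl⟩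
  obtain ⟨u, hu'⟩ : ∃ u, 4*t-m^2 = u := ⟨_, rfl⟩
  rw [hσ, hu']
  rw [hu'] at hu
  have hDr : (dsc a b : ℝ) = -(u*σ^2) := by
    rw [dsc]; push_cast; rw [ha, hb, ← hσ, ← hu', hm]
    have : t ≠ 0 := ht0
    have : τ = 1/t := hτ.symm
    rw [this]; field_simp; ring
  have hut : u ≤ 4*t := by rw [← hu']; nlinarith
  have hm2 : m^2 < 4*t := by linarith
  by_cases ht3 : t < 3
  · clear hc he hm hkm htτ
    have hkl : -2 < k ∧ k < 2 := abs_lt_of_sq_lt_sq' (by linarith) (by norm_num)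
    have hml : -4 < m ∧ m < 4 := abs_lt_of_sq_lt_sq' (by linarith) (by norm_num)
    have hτ21 : τ^2 ≤ 1 := by nlinarith
    have hτ20 : 0 ≤ τ^2 := by positivity
    have a1 : (a:ℝ) < 6 := by linarith
    have a2 : (-6:ℝ) < a := by linarith
    have b1 : (b:ℝ) < 6 := by linarith
    have b2 : (-6:ℝ) < b := by linarith
    have a1' : a < 6 := by exact_mod_cast a1
    have a2' : -6 < a := by exact_mod_cast a2
    have b1' : b < 6 := by exact_mod_cast b1
    have b2' : -6 < b := by exact_mod_cast b2
    have hd := neg_box1 a (Finset.mem_Icc.2 ⟨by omega, by omega⟩) b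
      (Finset.mem_Icc.2 ⟨by omega, by omega⟩) h1 h2 hD
    have hdr : (dsc a b : ℝ) ≤ -23 := by exact_mod_cast hd
    have hσl : -6 ≤ σ ∧ σ ≤ 6 := ⟨by linarith, by linarith⟩
    have hσ2 : σ^2 ≤ 6^2 := sq_le_sq' hσl.1 hσl.2
    have hu2 : u^2 ≤ 12^2 := sq_le_sq' (by linarith) (by linarith)
    nlinarith [sq_nonneg (u - 2*σ)]
  · push Not at ht3
    have hτ3 : τ ≤ 1/3 := by clear hb ha hDr hσ hu' hm; nlinarith
    have hτ29 : τ^2 ≤ 1/9 := by nlinarith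
    have hτ20 : 0 ≤ τ^2 := by positivity
    have hkl : -1.155 < k ∧ k < 1.155 := abs_lt_of_sq_lt_sq' (by linarith) (by norm_num)
    have hσt : t - 1.155 ≤ σ := by linarith
    by_cases hu5 : 1/5 ≤ u
    · have hc1 : 0 ≤ (u - 1/5)*(7*σ - u) := mul_nonneg (by linarith) (by linarith)
      have hs1 : 1.845 ≤ σ := by linarith
      have hs2 : 1.845*σ ≤ σ^2 := by nlinarith
      have hs3 : 0 ≤ u*σ*(σ-1.845) := by
        apply mul_nonneg _ (by linarith)
        exact mul_nonneg hu.le (by linarith)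
      nlinarith
    · exfalso
      push Not at hu5
      have hcr : (b:ℝ)^2 - 4*a = -u - 2*k + τ^2 := by
        rw [ha, hb, ← hu', hkm]; linear_combination (0:ℝ)*htτ
      have hcz : 1 ≤ b^2 - 4*a ∨ b^2 - 4*a ≤ -1 := by
        rcases lt_trichotomy (b^2 - 4*a) 0 with h | h | h
        · right; linarith
        · exact absurd (by linarith) hc
        · left; linarith
      have hk34 : 0.34^2 ≤ k^2 := by
        rcases hcz with h | h
        · have h : (1:ℝ) ≤ (b:ℝ)^2 - 4*a := by exact_mod_cast h
          nlinarith
        · have h : (b:ℝ)^2 - 4*a ≤ (-1:ℝ) := by exact_mod_cast h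
          nlinarith
      have hτl : 0.0289 ≤ τ := by nlinarith
      have htl : t < 35 := by nlinarith
      have hml : -12 < m ∧ m < 12 := abs_lt_of_sq_lt_sq' (by linarith) (by norm_num)
      have a1 : (a:ℝ) < 37 := by linarith
      have a2 : (-1:ℝ) < a := by linarith
      have b1 : (b:ℝ) < 14 := by linarith
      have b2 : (-14:ℝ) < b := by linarith
      have a1' : a < 37 := by exact_mod_cast a1
      have a2' : -1 < a := by exact_mod_cast a2
      have b1' : b < 14 := by exact_mod_cast b1
      have b2' : -14 < b := by exact_mod_cast b2
      have hd := neg_box2 a (Finset.mem_Icc.2 ⟨by omega, by omega⟩) b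
        (Finset.mem_Icc.2 ⟨by omega, by omega⟩) h1 h2 hD hc he
      have hdr : (2*(a:ℝ)+5)^2 ≤ 20*(-(dsc a b:ℝ)) := by exact_mod_cast hd
      have hσa : 2*σ ≤ 2*a + 5 := by linarith
      have hσ0 : 0 < σ := by linarith
      have : 0 < σ^2 := by positivity
      nlinarith

lemma dsc_swap (a b : ℤ) : dsc a b = dsc b a := by rw [dsc, dsc]; ring

lemma count_aux (S : Set (ℤ × ℤ)) (a0 b0 : ℤ) (A B C d : ℝ) (hd : 4*A*C - B^2 = d)
    (e : ℤ × ℤ)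
    (h : ∀ q ∈ S, dsc q.1 q.2 = dsc a0 b0 ∧ (q ∈ smallSet a0 b0 A B C d ∨
      q.swap ∈ smallSet a0 b0 A B C d ∨ q.1^2 = 4*q.2 ∨ q.2^2 = 4*q.1 ∨ q = e ∨ q.swap = e)) :
    S.encard ≤ 60 := by
  have h24 := small_card a0 b0 A B C d hd
  have h1 := excep (dsc a0 b0)
  set T := smallSet a0 b0 A B C d
  set U := {q : ℤ × ℤ | q.1^2 = 4*q.2 ∧ dsc q.1 q.2 = dsc a0 b0}
  have hV : (T ∪ U ∪ {e}).encard ≤ 26 := by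
    refine (Set.encard_union_le _ _).trans ?_
    refine (add_le_add_left (Set.encard_union_le _ _) _).trans ?_
    rw [Set.encard_singleton]
    refine (add_le_add_left (add_le_add h24 h1) _).trans ?_
    norm_num
  have hV' : (Prod.swap '' (T ∪ U ∪ {e})).encard ≤ 26 :=
    (Set.encard_image_le _ _).trans hV
  have hsub : S ⊆ (T ∪ U ∪ {e}) ∪ Prod.swap '' (T ∪ U ∪ {e}) := by
    intro q hq
    obtain ⟨hD, h⟩ := h q hq
    rcases h with h | h | h | h | h | h
    · exact Or.inl (Or.inl (Or.inl h))
    · exact Or.inr ⟨q.swap, Or.inl (Or.inl h), by simp⟩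
    · exact Or.inl (Or.inl (Or.inr ⟨h, hD⟩))
    · exact Or.inr ⟨q.swap, Or.inl (Or.inr ⟨h, by rw [← hD, dsc_swap]; rfl⟩), by simp⟩
    · exact Or.inl (Or.inr h)
    · exact Or.inr ⟨q.swap, Or.inr h, by simp⟩
  refine (Set.encard_le_encard hsub).trans ((Set.encard_union_le _ _).trans
    ((add_le_add hV hV').trans ?_))
  norm_num

lemma neg_small (a0 b0 : ℤ) (t0 p0 κ : ℝ) (hκ : t0*κ = 1) (ha0 : (a0:ℝ) = t0 + p0)
    (hb0 : (b0:ℝ) = t0*p0 + κ) (hq0 : 0 < 4*κ - p0^2)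
    (x y z w a b : ℤ) (h : FRel a0 b0 x y z w a b) (hle : (z:ℝ) + t0*w ≤ x + t0*y)
    (h1 : a ≠ b) (h2 : a + b ≠ -2) (hD : dsc a b < 0)
    (hc : a^2 ≠ 4*b) (he : ¬ (b = 12 ∧ a = -7)) :
    ((4*κ - p0^2 + 2*(t0^2-p0*t0+κ))*x^2 + (2*(4*κ - p0^2)*t0 + 2*(t0^2-p0*t0+κ)*p0)*x*y
      + ((4*κ - p0^2)*t0^2 + 2*(t0^2-p0*t0+κ)*κ)*y^2)^2 <
      27*((4*κ - p0^2)*(t0^2-p0*t0+κ)^2) := by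
  obtain ⟨g1, g2, g3, g4, g5⟩ := h
  have g1 : ((x:ℝ)*w - y*z)^2 = 1 := by exact_mod_cast g1
  have g2 : (x:ℝ)^3 + a0*x^2*y + b0*x*y^2 + y^3 = 1 := by rw [cform] at g2; exact_mod_cast g2
  have g3 : (z:ℝ)^3 + a0*z^2*w + b0*z*w^2 + w^3 = 1 := by rw [cform] at g3; exact_mod_cast g3
  have g4 : (a:ℝ) = 3*x^2*z + a0*(x^2*w + 2*x*y*z) + b0*(2*x*y*w + y^2*z) + 3*y^2*w := by
    exact_mod_cast g4
  have g5 : (b:ℝ) = 3*z^2*x + a0*(z^2*y + 2*z*w*x) + b0*(2*z*w*y + w^2*x) + 3*w^2*y := by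
    exact_mod_cast g5
  rw [ha0, hb0] at g2 g3 g4 g5
  obtain ⟨q0, hq⟩ : ∃ q0, q0 = 4*κ - p0^2 := ⟨_, rfl⟩
  obtain ⟨s0, hs⟩ : ∃ s0, s0 = t0^2-p0*t0+κ := ⟨_, rfl⟩
  obtain ⟨l, hl⟩ : ∃ l, l = x + t0*y := ⟨_, rfl⟩
  obtain ⟨u, hu⟩ : ∃ u, u = z + t0*w := ⟨_, rfl⟩
  obtain ⟨Qv, hQv⟩ : ∃ Qv, Qv = x^2 + p0*x*y + κ*y^2 := ⟨_, rfl⟩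
  obtain ⟨Qw, hQw⟩ : ∃ Qw, Qw = z^2 + p0*z*w + κ*w^2 := ⟨_, rfl⟩
  obtain ⟨N, hN⟩ : ∃ N, N = 2*x*z + p0*(x*w+y*z) + 2*κ*y*w := ⟨_, rfl⟩
  have k1 : l*Qv = 1 := by rw [hl, hQv]; linear_combination g2 + y^3*hκ
  have k2 : u*Qw = 1 := by rw [hu, hQw]; linear_combination g3 + w^3*hκ
  have ka : (a:ℝ) = l*N + u*Qv := by
    rw [hl, hQv, hN, hu, g4]; linear_combination (-3*y^2*w)*hκ
  have kb : (b:ℝ) = l*Qw + u*N := by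
    rw [hl, hQw, hN, hu, g5]; linear_combination (-3*w^2*y)*hκ
  have kq : 4*Qv*Qw - N^2 = q0 := by
    have : 4*Qv*Qw - N^2 = q0*((x:ℝ)*w - y*z)^2 := by rw [hQv, hQw, hN, hq]; ring
    rw [this, g1, mul_one]
  have ks : l^2*Qw - l*u*N + u^2*Qv = s0 := by
    have : l^2*Qw - l*u*N + u^2*Qv = s0*((x:ℝ)*w - y*z)^2 := by
      rw [hQv, hQw, hN, hs, hl, hu]; ring
    rw [this, g1, mul_one]
  have hΨ : ((4*κ - p0^2 + 2*(t0^2-p0*t0+κ))*x^2 + (2*(4*κ - p0^2)*t0 + 2*(t0^2-p0*t0+κ)*p0)*x*y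
      + ((4*κ - p0^2)*t0^2 + 2*(t0^2-p0*t0+κ)*κ)*y^2) = q0*l^2 + 2*s0*Qv := by
    rw [hq, hs, hl, hQv]; ring
  rw [hΨ, ← hq, ← hs]
  rw [← hq] at hq0
  rw [← hl, ← hu] at hle
  have hQQ : 0 < 4*Qv*Qw := by
    have : 4*Qv*Qw = q0 + N^2 := by linear_combination kq
    rw [this]; positivity
  have hκ0 : 0 < κ := by rw [hq] at hq0; linarith [sq_nonneg p0]
  have hQvpos : 0 < Qv := by
    have h0 : 0 ≤ 4*Qv*κ := by
      have : 4*Qv*κ = (2*κ*y + p0*x)^2 + q0*x^2 := by rw [hQv, hq]; ring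
      rw [this]; positivity
    rcases lt_trichotomy Qv 0 with h | h | h
    · exfalso
      have := mul_neg_of_neg_of_pos h hκ0
      linarith
    · rw [h] at hQQ; simp at hQQ
    · exact h
  have hQwpos : 0 < Qw := by
    by_contra h
    push Not at h
    have := mul_nonpos_of_nonneg_of_nonpos hQvpos.le h
    linarith
  have hlpos : 0 < l := by
    by_contra h
    push Not at h
    have := mul_nonpos_of_nonpos_of_nonneg h hQvpos.le
    linarith
  have hupos : 0 < u := by
    by_contra h
    push Not at h
    have := mul_nonpos_of_nonpos_of_nonneg h hQwpos.le
    linarith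
  have htt : (l*Qw)*(u*Qv) = 1 := by linear_combination (u*Qw)*k1 + k2
  have hT0 : l*Qw ≠ 0 := by positivity
  have hinv : 1/(l*Qw) = u*Qv := by
    rw [div_eq_iff hT0]; linear_combination -htt
  have hdiv : l*N/(l*Qw) = u*N := by
    rw [div_eq_iff hT0]; linear_combination (-l*N)*k2
  have hinv2 : 1/(l*Qw)^2 = (u*Qv)^2 := by rw [← hinv]; field_simp
  have hT1 : 1 ≤ l*Qw := by rw [← k2]; exact mul_le_mul_of_nonneg_right hle hQwpos.le
  have hU : 4*(l*Qw) - (l*N)^2 = q0*l^2 := by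
    rw [← kq]; linear_combination (-4*l*Qw)*k1
  have hS : l*Qw - u*N + (u*Qv)^2 = s0*Qv := by
    rw [← ks]; linear_combination (-l*Qw + u*N)*k1
  have hfin := neg_case b a (l*Qw) (l*N) hT1 (by rw [kb, hdiv]) (by rw [ka, hinv])
    (by rw [hU]; positivity) h1.symm (by rwa [add_comm]) (by rwa [dsc_swap]) hc he
  rw [hdiv, hinv2, hU, hS] at hfin
  calc (q0*l^2 + 2*s0*Qv)^2 = (q0*l^2 + 2*(s0*Qv))^2 := by ring
    _ < _ := hfin
    _ = 27*(q0*s0^2)*(l*Qv)^2 := by ring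
    _ = _ := by rw [k1]; ring

theorem count_main (S : Set (ℤ × ℤ))
    (hirr : ∀ q ∈ S, q.1 ≠ q.2 ∧ q.1 + q.2 ≠ -2 ∧ dsc q.1 q.2 ≠ 0)
    (hrel : ∀ p ∈ S, ∀ q ∈ S, ∃ x y z w, FRel p.1 p.2 x y z w q.1 q.2) : S.encard ≤ 60 := by
  rcases S.eq_empty_or_nonempty with rfl | ⟨⟨a0, b0⟩, h0⟩
  · simp
  have hdsc : ∀ q ∈ S, dsc q.1 q.2 = dsc a0 b0 := by
    intro q hq
    obtain ⟨x, y, z, w, h⟩ := hrel _ h0 q hq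
    exact h.dsc
  have hne := (hirr _ h0).2.2
  simp only at hne
  rcases lt_or_gt_of_ne hne with hneg | hpos
  · -- negative discriminant
    obtain ⟨t0, ht0, hroot⟩ : ∃ t : ℝ, 0 < t ∧ t^3 - a0*t^2 + b0*t - 1 = 0 := by
      have hcont : ContinuousOn (fun t : ℝ => t^3 - a0*t^2 + b0*t - 1)
          (Set.Icc 0 (1 + |(a0:ℝ)| + |(b0:ℝ)|)) := by fun_prop
      have hM : (0:ℝ) ≤ 1 + |(a0:ℝ)| + |(b0:ℝ)| := by positivity
      obtain ⟨t, ht, h⟩ := intermediate_value_Icc hM hcont (show (0:ℝ) ∈ _ by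
        constructor
        · norm_num
        · have e1 := le_abs_self (a0:ℝ)
          have e2 := neg_abs_le (b0:ℝ)
          have e3 := abs_nonneg (a0:ℝ)
          have e4 := abs_nonneg (b0:ℝ)
          generalize |(a0:ℝ)| = u at *
          generalize |(b0:ℝ)| = v at *
          have f1 : a0*(1+u+v)^2 ≤ u*(1+u+v)^2 := mul_le_mul_of_nonneg_right e1 (by positivity)
          have f2 : -v*(1+u+v) ≤ b0*(1+u+v) := mul_le_mul_of_nonneg_right e2 (by positivity)
          have f3 : 0 ≤ (u + v)*(1+u+v) := by positivity
          have f4 : 0 ≤ v*(u+v)*(1+u+v) := by positivity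
          nlinarith)
      refine ⟨t, lt_of_le_of_ne ht.1 ?_, h⟩
      rintro rfl
      norm_num at h
    obtain ⟨κ, hκ⟩ : ∃ κ, t0*κ = 1 := ⟨1/t0, by field_simp⟩
    have ha0 : (a0:ℝ) = t0 + (a0 - t0) := by ring
    have hb0 : (b0:ℝ) = t0*(a0-t0) + κ := by
      have : t0*(b0:ℝ) = t0*(t0*(a0-t0) + κ) := by linear_combination hroot - hκ
      exact mul_left_cancel₀ ht0.ne' this
    generalize (a0:ℝ) - t0 = p0 at ha0 hb0
    have hD : (dsc a0 b0 : ℝ) = -((4*κ - p0^2)*(t0^2-p0*t0+κ)^2) := by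
      rw [dsc]; push_cast; rw [ha0, hb0]
      have : κ = 1/t0 := by field_simp; linarith
      rw [this]; field_simp; ring
    have hDr : (dsc a0 b0 : ℝ) < 0 := by exact_mod_cast hneg
    have hq0 : 0 < 4*κ - p0^2 := by
      by_contra h; push Not at h
      nlinarith [sq_nonneg (t0^2-p0*t0+κ)]
    refine count_aux S a0 b0 (4*κ - p0^2 + 2*(t0^2-p0*t0+κ))
      (2*(4*κ - p0^2)*t0 + 2*(t0^2-p0*t0+κ)*p0) ((4*κ - p0^2)*t0^2 + 2*(t0^2-p0*t0+κ)*κ)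
      (12*((4*κ - p0^2)*(t0^2-p0*t0+κ)^2)) ?_ (-7, 12) ?_
    · have : κ = 1/t0 := by field_simp; linarith
      rw [this]; field_simp; ring
    · rintro ⟨a, b⟩ hq
      obtain ⟨h1, h2, -⟩ := hirr _ hq
      have hdq := hdsc _ hq
      refine ⟨hdq, ?_⟩
      simp only [Prod.swap, Prod.mk.injEq] at *
      by_cases c1 : a^2 = 4*b
      · tauto
      by_cases c2 : b^2 = 4*a
      · tauto
      by_cases c3 : a = -7 ∧ b = 12
      · tauto
      by_cases c4 : b = -7 ∧ a = 12
      · tauto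
      obtain ⟨x, y, z, w, h⟩ := hrel _ h0 _ hq
      rcases le_total ((z:ℝ) + t0*w) (x + t0*y) with hle | hle
      · left
        refine ⟨x, y, z, w, h, ?_⟩
        refine (neg_small a0 b0 t0 p0 κ hκ ha0 hb0 hq0 x y z w a b h hle h1 h2 (hdq ▸ hneg) c1
          (by tauto)).trans_eq (by ring)
      · right; left
        refine ⟨z, w, x, y, h.swap, ?_⟩
        refine (neg_small a0 b0 t0 p0 κ hκ ha0 hb0 hq0 z w x y b a h.swap hle (Ne.symm h1)
          (by rwa [add_comm]) (by rw [dsc_swap]; exact hdq ▸ hneg) c2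
          (by tauto)).trans_eq (by ring)
  · refine count_aux S a0 b0 (a0^2-3*b0) (a0*b0-9) (b0^2-3*a0) (3*dsc a0 b0) ?_ (-9, 20) ?_
    · rw [dsc]; push_cast; ring
    · rintro ⟨a, b⟩ hq
      obtain ⟨h1, h2, -⟩ := hirr _ hq
      have hdq := hdsc _ hq
      refine ⟨hdq, ?_⟩
      simp only [Prod.swap, Prod.mk.injEq] at *
      by_cases c1 : a^2 = 4*b
      · tauto
      by_cases c2 : b^2 = 4*a
      · tauto
      by_cases c3 : a = -9 ∧ b = 20
      · tauto
      by_cases c4 : b = -9 ∧ a = 20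
      · tauto
      obtain ⟨x, y, z, w, h⟩ := hrel _ h0 _ hq
      rcases le_total (a^2 - 3*b) (b^2-3*a) with hle | hle
      · left
        refine ⟨x, y, z, w, h, ?_⟩
        have hh : ((a0^2 - 3*b0)*x^2 + (a0*b0 - 9)*x*y + (b0^2 - 3*a0)*y^2 : ℝ) = a^2 - 3*b := by
          exact_mod_cast h.hess
        have := pos_case a b h1 h2 (hdq ▸ hpos) hle c1 c3
        rw [hdq] at this
        have : 4*((a:ℝ)^2-3*b)^2 < 27*dsc a0 b0 := by exact_mod_cast this
        rw [hh]; linarith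
      · right; left
        refine ⟨z, w, x, y, h.swap, ?_⟩
        have hh : ((a0^2 - 3*b0)*z^2 + (a0*b0 - 9)*z*w + (b0^2 - 3*a0)*w^2 : ℝ) = b^2 - 3*a := by
          exact_mod_cast h.swap.hess
        have := pos_case b a (Ne.symm h1) (by rwa [add_comm]) (by rw [dsc_swap]; exact hdq ▸ hpos)
          hle c2 c4
        rw [dsc_swap, hdq] at this
        have : 4*((b:ℝ)^2-3*a)^2 < 27*dsc a0 b0 := by exact_mod_cast this
        rw [hh]; linarith

/-- `θ` is a root of the cubic and `1, θ, θ²` are independent over the integers -/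
def GoodRoot {K : Type*} [Field K] (a b : ℤ) (θ : K) : Prop :=
  θ^3 + a*θ^2 + b*θ + 1 = 0 ∧
    ∀ i j k : ℤ, (i:K) + j*θ + k*(θ^2 + a*θ + b) = 0 → i = 0 ∧ j = 0 ∧ k = 0

lemma mem_adjoin_form {K : Type*} [Field K] {a b : ℤ} {θ : K} (h : GoodRoot a b θ) {α : K}
    (hα : α ∈ Algebra.adjoin ℤ {θ}) :
    ∃ i j k : ℤ, α = i + j*θ + k*(θ^2 + a*θ + b) := by
  have hθ := h.1
  induction hα using Algebra.adjoin_induction with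
  | mem x hx =>
    rw [Set.mem_singleton_iff] at hx
    exact ⟨0, 1, 0, by rw [hx]; push_cast; ring⟩
  | algebraMap r => exact ⟨r, 0, 0, by simp⟩
  | add x y _ _ hx hy =>
    obtain ⟨i, j, k, rfl⟩ := hx
    obtain ⟨i', j', k', rfl⟩ := hy
    exact ⟨i+i', j+j', k+k', by push_cast; ring⟩
  | mul x y _ _ hx hy =>
    obtain ⟨i, j, k, rfl⟩ := hx
    obtain ⟨i', j', k', rfl⟩ := hy
    refine ⟨i*i' - b*j*j' - a*k*k' - j*k' - j'*k, i*j' + i'*j - a*j*j' - k*k',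
      i*k' + i'*k + j*j' + b*k*k', ?_⟩
    push_cast
    linear_combination ((j:K)*k' + j'*k + k*k'*(θ + a)) * hθ

lemma goodRoot_rel {K : Type*} [Field K] {a0 b0 a b : ℤ} {θ0 θ : K}
    (h0 : GoodRoot a0 b0 θ0) (h : GoodRoot a b θ)
    (hadj : Algebra.adjoin ℤ {θ0} = Algebra.adjoin ℤ {θ}) :
    ∃ x y z w, FRel a0 b0 x y z w a b := by
  have mθ : θ ∈ Algebra.adjoin ℤ {θ0} := by rw [hadj]; exact Algebra.self_mem_adjoin_singleton ℤ θ
  have mθ0 : θ0 ∈ Algebra.adjoin ℤ {θ} := by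
    rw [← hadj]; exact Algebra.self_mem_adjoin_singleton ℤ θ0
  have mm : ∀ (c d : ℤ) (η : K), η^2 + c*η + d ∈ Algebra.adjoin ℤ {η} := by
    intro c d η
    have hη := Algebra.self_mem_adjoin_singleton ℤ η
    refine add_mem (add_mem (pow_mem hη 2) (mul_mem (intCast_mem _ c) hη)) (intCast_mem _ d)
  have mμ : θ^2 + a*θ + b ∈ Algebra.adjoin ℤ {θ0} := by rw [hadj]; exact mm a b θ
  have mμ0 : θ0^2 + a0*θ0 + b0 ∈ Algebra.adjoin ℤ {θ} := by rw [← hadj]; exact mm a0 b0 θ0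
  obtain ⟨i, x, y, e1⟩ := mem_adjoin_form h0 mθ
  obtain ⟨j, z, w, e2⟩ := mem_adjoin_form h0 mμ
  obtain ⟨i', x', y', e3⟩ := mem_adjoin_form h mθ0
  obtain ⟨j', z', w', e4⟩ := mem_adjoin_form h mμ0
  obtain ⟨r0, l0⟩ := h0
  obtain ⟨r, l⟩ := h
  obtain ⟨μ0, hμ0⟩ : ∃ μ0, θ0^2 + a0*θ0 + b0 = μ0 := ⟨_, rfl⟩
  obtain ⟨μ, hμ⟩ : ∃ μ, θ^2 + a*θ + b = μ := ⟨_, rfl⟩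
  rw [hμ0] at e1 e2 e4 l0
  rw [hμ] at e2 e3 e4 l
  have p0 : θ0*μ0 = -1 := by rw [← hμ0]; linear_combination r0
  have p : θ*μ = -1 := by rw [← hμ]; linear_combination r
  have sq0 : θ0^2 = μ0 - a0*θ0 - b0 := by rw [← hμ0]; ring
  have sq : θ^2 = μ - a*θ - b := by rw [← hμ]; ring
  have tq0 : μ0^2 = b0*μ0 - a0 - θ0 := by
    linear_combination μ0*(-hμ0) + (θ0 + a0) * p0
  have tq : μ^2 = b*μ - a - θ := by
    linear_combination μ*(-hμ) + (θ + a) * p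
  clear mθ mθ0 mμ mμ0 mm hadj
  -- matrix inverse
  obtain ⟨-, d1, d2⟩ := l0 (i' + x'*i + y'*j) (x'*x + y'*z - 1) (x'*y + y'*w) (by
    push_cast
    linear_combination -e3 - x'*e1 - y'*e2)
  obtain ⟨-, d3, d4⟩ := l0 (j' + z'*i + w'*j) (z'*x + w'*z) (z'*y + w'*w - 1) (by
    push_cast
    linear_combination -e4 - z'*e1 - w'*e2)
  rw [e1, e2] at sq p
  rw [e1, e2] at tq
  obtain ⟨-, f1, f2⟩ := l0 (i^2 - b0*x^2 - a0*y^2 - 2*x*y - (j - a*i - b))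
    (-a0*x^2 - y^2 + 2*i*x - z + a*x) (x^2 + b0*y^2 + 2*i*y - w + a*y) (by
    push_cast
    linear_combination sq - x^2*sq0 - y^2*tq0 - 2*x*y*p0)
  obtain ⟨-, f3, f4⟩ := l0 (i*j - b0*x*z - a0*y*w - (x*w+y*z) + 1)
    (-a0*x*z - y*w + i*z + j*x) (x*z + b0*y*w + i*w + j*y) (by
    push_cast
    linear_combination p - x*z*sq0 - y*w*tq0 - (x*w+y*z)*p0)
  obtain ⟨-, f5, f6⟩ := l0 (j^2 - b0*z^2 - a0*w^2 - 2*z*w - (b*j - a - i))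
    (-a0*z^2 - w^2 + 2*j*z - b*z + x) (z^2 + b0*w^2 + 2*j*w - b*w + y) (by
    push_cast
    linear_combination tq - z^2*sq0 - w^2*tq0 - 2*z*w*p0)
  clear e1 e2 e3 e4 sq tq p sq0 tq0 p0 l l0 r r0 hμ hμ0
  have hdet : (x'*w' - y'*z')*(x*w - y*z) = 1 := by
    linear_combination d1*(z'*y+w'*w) - d2*(z'*x+w'*z) + d4
  obtain ⟨ε, hε⟩ : ∃ ε, ε = x*w - y*z := ⟨_, rfl⟩
  have hε2 : ε^2 = 1 := by
    rw [← hε] at hdet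
    have : IsUnit ε := IsUnit.of_mul_eq_one _ (by rw [mul_comm]; exact hdet)
    rcases Int.isUnit_iff.1 this with h | h <;> rw [h] <;> norm_num
  have hv : cform a0 b0 x y = ε := by rw [cform, hε]; linear_combination x*f2 - y*f1
  have hw : cform a0 b0 z w = ε := by rw [cform, hε]; linear_combination z*f6 - w*f5
  have hi : -(i*ε) = a0*x*y*z + y^2*w + x^2*z + b0*x*y*w := by
    rw [hε]; linear_combination y*f3 - x*f4
  have hj : j*ε = a0*x*z*w + y*w^2 + x*z^2 + b0*y*z*w := by
    rw [hε]; linear_combination w*f3 - z*f4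
  have ha : ε*a = 3*x^2*z + a0*(x^2*w + 2*x*y*z) + b0*(2*x*y*w + y^2*z) + 3*y^2*w := by
    rw [hε] at hi ⊢; linear_combination w*f1 - z*f2 + 2*hi
  have hb : ε*b = 3*z^2*x + a0*(z^2*y + 2*z*w*x) + b0*(2*z*w*y + w^2*x) + 3*w^2*y := by
    rw [hε] at hj ⊢; linear_combination -(x*f6 - y*f5) + 2*hj
  have hε3 : ε^3 = ε := by linear_combination ε*hε2
  refine ⟨ε*x, ε*y, ε*z, ε*w, ?_, ?_, ?_, ?_, ?_⟩
  · have : (ε*x*(ε*w) - ε*y*(ε*z)) = ε^2*ε := by rw [hε]; ring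
    rw [this, hε2, one_mul, hε2]
  · have : cform a0 b0 (ε*x) (ε*y) = ε^3*cform a0 b0 x y := by rw [cform, cform]; ring
    rw [this, hv, hε3]; linear_combination hε2
  · have : cform a0 b0 (ε*z) (ε*w) = ε^3*cform a0 b0 z w := by rw [cform, cform]; ring
    rw [this, hw, hε3]; linear_combination hε2
  · linear_combination ε^3*ha - (ε^2+1)*a*hε2
  · linear_combination ε^3*hb - (ε^2+1)*b*hε2

lemma goodRoot_irr {K : Type*} [Field K] {a b : ℤ} {θ : K} (h : GoodRoot a b θ) :
    a ≠ b ∧ a + b ≠ -2 ∧ dsc a b ≠ 0 := by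
  obtain ⟨r, l⟩ := h
  have l' : ∀ i j k : ℤ, (i:K) + j*θ + k*θ^2 = 0 → i = 0 ∧ j = 0 ∧ k = 0 := by
    intro i j k h
    obtain ⟨h1, h2, h3⟩ := l (i - k*b) (j - k*a) k (by push_cast; linear_combination h)
    subst h3
    refine ⟨by linarith, by linarith, rfl⟩
  have hab : a ≠ b := by
    rintro rfl
    have : (((1:ℤ):K) + (1:ℤ)*θ + (0:ℤ)*θ^2) * (((1:ℤ):K) + ((a-1:ℤ):K)*θ + (1:ℤ)*θ^2) = 0 := by
      push_cast; linear_combination r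
    rcases mul_eq_zero.1 this with h | h
    · have := (l' _ _ _ h).1; norm_num at this
    · have := (l' _ _ _ h).1; norm_num at this
  refine ⟨hab, ?_, ?_⟩
  · intro hs
    have hb : b = -2 - a := by linarith
    rw [hb] at r
    have : (((-1:ℤ):K) + (1:ℤ)*θ + (0:ℤ)*θ^2) * (((-1:ℤ):K) + ((a+1:ℤ):K)*θ + (1:ℤ)*θ^2) = 0 := by
      push_cast at r ⊢; linear_combination r
    rcases mul_eq_zero.1 this with h | h
    · have := (l' _ _ _ h).1; norm_num at this
    · have := (l' _ _ _ h).1; norm_num at this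
  · intro hD
    have hDK : (a:K)^2*b^2 - 4*a^3 - 4*b^3 + 18*a*b - 27 = 0 := by
      rw [dsc] at hD; exact_mod_cast congrArg (Int.cast : ℤ → K) hD
    have : (((a^2*b+3*a-4*b^2:ℤ):K) + ((2*a^3-7*a*b+9:ℤ):K)*θ + ((2*a^2-6*b:ℤ):K)*θ^2) *
        (((b:ℤ):K) + ((2*a:ℤ):K)*θ + ((3:ℤ):K)*θ^2) = 0 := by
      push_cast
      linear_combination hDK + (3*(2*(a:K)^2-6*b)*θ + 3*(2*(a:K)^3-7*a*b+9)
        - a*(2*(a:K)^2-6*b)) * r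
    rcases mul_eq_zero.1 this with h | h
    · obtain ⟨-, h2, h3⟩ := l' _ _ _ h
      have h3' : a^2 = 3*b := by linarith
      have h27 : a^3 = 27 := by linear_combination (-3)*h2 + 7*a*h3'
      have ha3 : a = 3 := by
        have : (a - 3)*(a^2 + 3*a + 9) = 0 := by linear_combination h27
        rcases mul_eq_zero.1 this with h | h
        · linarith
        · nlinarith [sq_nonneg (2*a+3)]
      apply hab
      subst ha3
      linarith
    · have := (l' _ _ _ h).2.2; norm_num at this

lemma quad_coeffs {i j k a b : ℚ}
    (h : C i + C j*X + C k*(X^2 + C a*X + C b) = 0) : i = 0 ∧ j = 0 ∧ k = 0 := by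
  have c0 := congrArg (fun g => coeff g 0) h
  have c1 := congrArg (fun g => coeff g 1) h
  have c2 := congrArg (fun g => coeff g 2) h
  simp [coeff_X, coeff_C] at c0 c1 c2
  subst c2
  simp at c0 c1
  exact ⟨c0, c1, rfl⟩

lemma goodRoot_of {K : Type*} [Field K] {a b : ℤ} (hirr : Irreducible (cubicPoly a b))
    (φ : AdjoinRoot (cubicPoly a b) ≃+* K) :
    GoodRoot a b (φ (AdjoinRoot.root (cubicPoly a b))) := by
  have hdeg : (cubicPoly a b).natDegree = 3 := by rw [cubicPoly]; compute_degree!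
  constructor
  · have h : AdjoinRoot.mk (cubicPoly a b)
        (X ^ 3 + C (a : ℚ) * X ^ 2 + C (b : ℚ) * X + 1) = 0 := AdjoinRoot.mk_self
    simpa using congrArg φ h
  · intro i j k h
    have hz : AdjoinRoot.mk (cubicPoly a b)
        (C (i:ℚ) + C (j:ℚ)*X + C (k:ℚ)*(X^2 + C (a:ℚ)*X + C (b:ℚ))) = 0 := by
      apply φ.injective
      rw [map_zero, ← h]
      simp
    rw [AdjoinRoot.mk_eq_zero] at hz
    have hg0 := Polynomial.eq_zero_of_dvd_of_natDegree_lt hz (by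
      rw [hdeg]
      have : (C (i:ℚ) + C (j:ℚ)*X + C (k:ℚ)*(X^2 + C (a:ℚ)*X + C (b:ℚ))).natDegree ≤ 2 := by
        compute_degree
      omega)
    exact_mod_cast quad_coeffs hg0

lemma adjoin_eq {K : Type*} [Field K] {f : ℚ[X]} (h : IsMaximalPoly f)
    (φ : AdjoinRoot f ≃+* K) :
    Algebra.adjoin ℤ {φ (AdjoinRoot.root f)} = integralClosure ℤ K := by
  let ψ : AdjoinRoot f ≃ₐ[ℤ] K := AlgEquiv.ofRingEquiv (f := φ) (by intro x; simp)
  have h1 := congrArg (Subalgebra.map ψ.toAlgHom) h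
  rw [AlgHom.map_adjoin, Set.image_singleton] at h1
  have h2 : Subalgebra.map ψ.toAlgHom (integralClosure ℤ (AdjoinRoot f)) = integralClosure ℤ K :=
    integralClosure_map_algEquiv ψ
  rw [h2] at h1
  exact h1

/-- Fix a cubic number field `K`. Then there are at most 60 pairs `(a, b) ∈ ℤ²` such
that `f = x³ + a x² + b x + 1` is irreducible, `ℤ[θ]` is the full ring of integers of
`ℚ[x]/(f)`, and `ℚ[x]/(f) ≅ K`. -/
theorem card_unit_monogenisers_le_sixty (K : Type*) [Field K] [NumberField K]
    (hK : Module.finrank ℚ K = 3) :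
    {p : ℤ × ℤ | Irreducible (cubicPoly p.1 p.2) ∧ IsMaximalPoly (cubicPoly p.1 p.2) ∧
      Nonempty (AdjoinRoot (cubicPoly p.1 p.2) ≃+* K)}.encard ≤ 60 := by
  apply count_main
  · rintro q ⟨h1, h2, ⟨φ⟩⟩
    exact goodRoot_irr (goodRoot_of h1 φ)
  · rintro p ⟨h1, h2, ⟨φ⟩⟩ q ⟨h1', h2', ⟨φ'⟩⟩
    exact goodRoot_rel (goodRoot_of h1 φ) (goodRoot_of h1' φ')
      ((adjoin_eq h2 φ).trans (adjoin_eq h2' φ').symm)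
end

section
/- For X > 0, let N(X) be the number of pairs (a, b) ∈ +B²₁₁ with max(a, b) ≤ X, and let E(X) be the number of such pairs for which the 2-torsion subgroup of the class group of K_{a,b} = ℚ[x]/(x³ + a x² + b x + 1) is trivial (has exactly 1 element). Then E(X) / N(X) → 0 as X → ∞; that is, all but a density-zero proportion of members of +B²₁₁ satisfy |Cl[2]| ≥ 2. -/
open Polynomial NumberField Filter

open scoped Classical in
/-- The cardinality of the 2-torsion subgroup of the class group of the field
`ℚ[x]/(f)`, for `f` an irreducible polynomial over `ℚ`; junk value `0` if `f` is
reducible. -/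
noncomputable def cl2CardOfPoly (f : ℚ[X]) : ℕ :=
  if h : Irreducible f then
    letI : Fact (Irreducible f) := ⟨h⟩
    Nat.card {I : ClassGroup (𝓞 (AdjoinRoot f)) // I ^ 2 = 1}
  else 0

/-- The family `+B²₁₁`: pairs `(a,b)` of positive integers with
`(a mod 4, b mod 4) ∈ {(0,0), (1,2), (2,1)}` such that `x³ + a x² + b x + 1` is
irreducible and maximal. -/
def InBFam (p : ℤ × ℤ) : Prop :=
  0 < p.1 ∧ 0 < p.2 ∧
    ((p.1 % 4, p.2 % 4) = (0, 0) ∨ (p.1 % 4, p.2 % 4) = (1, 2) ∨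
      (p.1 % 4, p.2 % 4) = (2, 1)) ∧
    Irreducible (cubicPoly p.1 p.2) ∧ IsMaximalPoly (cubicPoly p.1 p.2)


/-- The number of members of `+B²₁₁` of symmetric height at most `X`. -/
noncomputable def NB (X : ℝ) : ℕ :=
  Nat.card {p : ℤ × ℤ | InBFam p ∧ (max p.1 p.2 : ℝ) ≤ X}

/-- The number of members of `+B²₁₁` of symmetric height at most `X` whose associated
cubic field has trivial 2-torsion class group. -/
noncomputable def EB (X : ℝ) : ℕ :=
  Nat.card {p : ℤ × ℤ | InBFam p ∧ (max p.1 p.2 : ℝ) ≤ X ∧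
    cl2CardOfPoly (cubicPoly p.1 p.2) = 1}


open scoped DirectSum in
/-- index of `2A` in a finitely generated abelian group. -/
lemma index_two_mul (A : Type*) [AddCommGroup A] [Module.Finite ℤ A] :
    (nsmulAddMonoidHom (α := A) 2).range.index =
      2 ^ Module.finrank ℤ A * Nat.card (nsmulAddMonoidHom (α := A) 2).ker := by
  have : AddGroup.FG A := Module.Finite.iff_addGroup_fg.mp inferInstance
  obtain ⟨n, ι, hι, p, hp, e, ⟨f⟩⟩ := AddCommGroup.equiv_free_prod_directSum_zmod A
  have : ∀ i, NeZero (p i ^ e i) := fun i => ⟨pow_ne_zero _ (hp i).ne_zero⟩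
  let T := ⨁ i : ι, ZMod (p i ^ e i)
  have : Finite T := by
    classical
    exact Finite.of_equiv _ (DirectSum.addEquivProd (fun i => ZMod (p i ^ e i))).symm.toEquiv
  let g : A ≃+ (Fin n → ℤ) × T :=
    f.trans (AddEquiv.prodCongr (Finsupp.linearEquivFunOnFinite ℤ ℤ (Fin n)).toAddEquiv
      (AddEquiv.refl T))
  have hrank : Module.finrank ℤ A = n := by
    rw [LinearEquiv.finrank_eq g.toIntLinearEquiv]
    have hT : Module.finrank ℤ T = 0 := by
      apply Module.finrank_eq_zero_of_rank_eq_zero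
      rw [rank_eq_zero_iff]
      intro x
      refine ⟨(Nat.card T : ℤ), by exact_mod_cast Nat.card_pos.ne', ?_⟩
      simp [natCast_zsmul]
    have : Module.Finite ℤ T := Module.Finite.of_finite
    rw [← Submodule.finrank_quotient_add_finrank (LinearMap.ker (LinearMap.fst ℤ (Fin n → ℤ) T)),
      LinearEquiv.finrank_eq (LinearMap.quotKerEquivOfSurjective _ LinearMap.fst_surjective),
      LinearMap.ker_fst, LinearMap.finrank_range_of_inj LinearMap.inr_injective, hT]
    simp
  have hidx : (nsmulAddMonoidHom (α := A) 2).range.index =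
      (nsmulAddMonoidHom (α := (Fin n → ℤ) × T) 2).range.index := by
    rw [← AddSubgroup.index_map_equiv _ g]
    congr 1
    ext x
    simp only [AddSubgroup.mem_map, AddMonoidHom.mem_range]
    constructor
    · rintro ⟨_, ⟨y, rfl⟩, rfl⟩
      exact ⟨g y, by simp⟩
    · rintro ⟨y, rfl⟩
      exact ⟨_, ⟨g.symm y, rfl⟩, by simp⟩
  have hker : Nat.card (nsmulAddMonoidHom (α := A) 2).ker =
      Nat.card (nsmulAddMonoidHom (α := T) 2).ker := by
    refine Nat.card_congr ⟨fun x => ⟨(g x.1).2, ?_⟩, fun x => ⟨g.symm (0, x.1), ?_⟩, ?_, ?_⟩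
    · have := x.2
      rw [AddMonoidHom.mem_ker] at this ⊢
      have h2 := congrArg (fun z => (g z).2) this
      simpa using h2
    · have := x.2
      rw [AddMonoidHom.mem_ker] at this ⊢
      rw [nsmulAddMonoidHom_apply] at this ⊢
      rw [← map_nsmul, Prod.smul_mk, this]
      simp
    · intro x
      have := x.2
      rw [AddMonoidHom.mem_ker] at this
      have h2 := congrArg (fun z => (g z).1) this
      have h3 : (g x.1).1 = 0 := by
        ext i
        have := congrFun h2 i
        simpa using this
      apply Subtype.ext
      apply g.injective
      simp only [AddEquiv.apply_symm_apply]
      rw [← h3]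
    · intro x
      apply Subtype.ext
      simp
  rw [hrank, hidx, hker]
  have hr : (nsmulAddMonoidHom (α := (Fin n → ℤ) × T) 2).range =
      (AddSubgroup.pi Set.univ (fun _ : Fin n => AddSubgroup.zmultiples (2:ℤ))).prod
        (nsmulAddMonoidHom (α := T) 2).range := by
    ext ⟨x, y⟩
    simp only [AddMonoidHom.mem_range, AddSubgroup.mem_prod, AddSubgroup.mem_pi, Int.mem_zmultiples_iff]
    constructor
    · rintro ⟨⟨a, b⟩, h⟩
      rw [nsmulAddMonoidHom_apply, Prod.smul_mk, Prod.mk.injEq] at h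
      refine ⟨fun i _ => ⟨a i, ?_⟩, b, h.2⟩
      rw [← h.1]; simp
    · rintro ⟨h, b, rfl⟩
      choose c hc using fun i => h i (Set.mem_univ i)
      refine ⟨(c, b), ?_⟩
      ext i
      · simp [hc]
      · simp
  rw [hr, AddSubgroup.index_prod, AddSubgroup.index_pi]
  congr 1
  · simp
  · exact AddSubgroup.index_range


lemma index_sq (A : Type*) [CommGroup A] [Module.Finite ℤ (Additive A)] :
    (powMonoidHom (α := A) 2).range.index =
      2 ^ Module.finrank ℤ (Additive A) * Nat.card (powMonoidHom (α := A) 2).ker := by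
  exact index_two_mul (Additive A)

/-- abstract form of the Hilbert Theorem 94 for quadratic extensions -/
lemma hilbert94_abstract (A B : Type*) [CommGroup A] [CommGroup B]
    [Module.Finite ℤ (Additive A)] [Module.Finite ℤ (Additive B)]
    (i : B →* A) (N : A →* B) (S : A →* A)
    (hiN : ∀ x, i (N x) = x * S x) (hNi : ∀ y, N (i y) = y ^ 2) (hSi : ∀ y, S (i y) = i y)
    (hrank : 2 * Module.finrank ℤ (Additive B) < Module.finrank ℤ (Additive A))
    (a₀ : A) (ha₀ : a₀ ^ 2 = 1) (ha₁ : a₀ ≠ 1) (haN : N a₀ = 1)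
    (hB : Nat.card (powMonoidHom (α := B) 2).ker = 2) :
    ∃ e, N e = 1 ∧ ∀ ε, e ≠ S ε / ε := by
  by_contra! H
  choose! E hE using H
  let R := N.ker
  let Nl : Additive A →ₗ[ℤ] Additive B := (MonoidHom.toAdditive N).toIntLinearMap
  let eR : Additive R ≃ₗ[ℤ] LinearMap.ker Nl :=
    AddEquiv.toIntLinearEquiv
      { toFun := fun x => ⟨Additive.ofMul (x.toMul : A), x.toMul.2⟩
        invFun := fun x => Additive.ofMul (⟨x.1.toMul, x.2⟩ : R)
        left_inv := fun x => rfl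
        right_inv := fun x => rfl
        map_add' := fun x y => rfl }
  have : Module.Finite ℤ (Additive R) := Module.Finite.equiv eR.symm
  have h1 : Module.finrank ℤ (Additive B) < Module.finrank ℤ (Additive R) := by
    have h2 := Submodule.finrank_quotient_add_finrank (LinearMap.ker Nl)
    rw [LinearEquiv.finrank_eq (LinearMap.quotKerEquivRange Nl)] at h2
    have h3 : Module.finrank ℤ (LinearMap.range Nl) ≤ Module.finrank ℤ (Additive B) :=
      Submodule.finrank_le _
    rw [LinearEquiv.finrank_eq eR]
    omega
  have hRi := index_sq R
  have hBi := index_sq B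
  rw [hB] at hBi
  have hRk : 2 ≤ Nat.card (powMonoidHom (α := R) 2).ker := by
    have hne : (powMonoidHom (α := R) 2).range.index ≠ 0 := by
      have : Group.FG R := by
        rw [GroupFG.iff_add_fg]; exact Module.Finite.iff_addGroup_fg.mp inferInstance
      exact (Subgroup.finiteIndex_range_powMonoidHom_of_fg R two_ne_zero).index_ne_zero
    have hk0 : Nat.card (powMonoidHom (α := R) 2).ker ≠ 0 := by
      intro h; rw [h, mul_zero] at hRi; exact hne hRi
    have hk1 : Nat.card (powMonoidHom (α := R) 2).ker ≠ 1 := by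
      intro h
      rw [Nat.card_eq_one_iff_unique] at h
      obtain ⟨h, _⟩ := h
      have := h.elim ⟨⟨a₀, haN⟩, by rw [MonoidHom.mem_ker]; exact Subtype.ext ha₀⟩ 1
      exact ha₁ (congrArg (fun z : (powMonoidHom (α := R) 2).ker => ((z : R) : A)) this)
    omega
  have hle : (powMonoidHom (α := R) 2).range.index ≤ (powMonoidHom (α := B) 2).range.index := by
    have hfin : Finite (B ⧸ (powMonoidHom (α := B) 2).range) := by
      apply Nat.finite_of_card_ne_zero
      change (powMonoidHom (α := B) 2).range.index ≠ 0
      rw [hBi]; positivity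
    refine Nat.card_le_card_of_injective
      (fun q : R ⧸ (powMonoidHom (α := R) 2).range =>
        (QuotientGroup.mk (N (E (q.out : R))) : B ⧸ (powMonoidHom (α := B) 2).range)) ?_
    intro q1 q2 h
    simp only [] at h
    rw [QuotientGroup.eq] at h
    obtain ⟨y, hy⟩ := h
    rw [powMonoidHom_apply] at hy
    rw [← QuotientGroup.out_eq' q1, ← QuotientGroup.out_eq' q2, QuotientGroup.eq]
    set e1 := q1.out
    set e2 := q2.out
    have hr : (E e1)⁻¹ * E e2 * (i y)⁻¹ ∈ R := by
      rw [MonoidHom.mem_ker]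
      simp only [map_mul, map_inv, hNi, hy]
      group
    set r : R := ⟨_, hr⟩ with hrdef
    have hSr : (r : A) * S r = 1 := by rw [← hiN, r.2, map_one]
    refine ⟨r⁻¹, ?_⟩
    apply Subtype.ext
    have hS2 : S r = (r : A)⁻¹ := (inv_eq_of_mul_eq_one_right hSr).symm
    have hr' : (r : A) = (E e1)⁻¹ * E e2 * (i y)⁻¹ := rfl
    have hS3 : S r = (S (E e1))⁻¹ * S (E e2) * (i y)⁻¹ := by
      rw [hr']; simp only [map_mul, map_inv, hSi]
    have e1' := hE e1 e1.2
    have e2' := hE e2 e2.2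
    rw [powMonoidHom_apply]
    push_cast
    rw [e1', e2']
    have : ((r : A)⁻¹) ^ 2 = S r * (r:A)⁻¹ := by rw [hS2, sq]
    rw [this, hS3, hr']
    simp only [div_eq_mul_inv, mul_inv, inv_inv]
    rw [show (S (E e1))⁻¹ * S (E e2) * (i y)⁻¹ * (E e1 * (E e2)⁻¹ * i y) =
      (S (E e1))⁻¹ * S (E e2) * (E e1 * (E e2)⁻¹) * ((i y)⁻¹ * i y) by ac_rfl]
    rw [inv_mul_cancel, mul_one]
    ac_rfl
  rw [hRi, hBi] at hle
  have : 2 ^ (Module.finrank ℤ (Additive B) + 1) ≤ 2 ^ Module.finrank ℤ (Additive R) :=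
    Nat.pow_le_pow_right (by norm_num) h1
  have h5 : 0 < 2 ^ Module.finrank ℤ (Additive B) := by positivity
  rw [pow_succ] at this
  nlinarith


theorem exists_cl2_of_ext (K L : Type*) [Field K] [Field L] [NumberField K] [NumberField L]
    [Algebra K L] [Algebra.IsQuadraticExtension K L] [IsUnramifiedAtInfinitePlaces K L]
    (σ : L ≃ₐ[K] L) (w v β : 𝓞 L) (hw : σ (w : L) = -(w : L)) (hwv : w * v = 1)
    (hβ : (β : L) - σ (β : L) = w) :
    ∃ c : ClassGroup (𝓞 K), c ^ 2 = 1 ∧ c ≠ 1 := by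
  classical
  have h2 : Module.finrank K L = 2 := Algebra.IsQuadraticExtension.finrank_eq_two K L
  let s : 𝓞 L ≃+* 𝓞 L := RingOfIntegers.mapRingEquiv (σ : L ≃+* L)
  have hs : ∀ x : 𝓞 L, ((s x : 𝓞 L) : L) = σ (x : L) := fun x => rfl
  have hw0 : w ≠ 0 := by rintro rfl; simp at hwv
  have hwL : (w : L) ≠ 0 := by simpa using hw0
  have hσ : σ ≠ 1 := by
    rintro rfl
    have h3 : (w : L) = -w := hw
    exact hwL (by linear_combination (1/2) * h3)
  have huniv : (Finset.univ : Finset (L ≃ₐ[K] L)) = {1, σ} := by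
    symm
    apply Finset.eq_univ_of_card
    rw [Finset.card_pair hσ.symm, ← Nat.card_eq_fintype_card, IsGalois.card_aut_eq_finrank, h2]
  have hnormL : ∀ x : L, algebraMap K L (Algebra.norm K x) = x * σ x := by
    intro x
    rw [Algebra.norm_eq_prod_automorphisms, huniv, Finset.prod_pair hσ.symm]
    rfl
  have hσσ : ∀ x : L, σ (σ x) = x := by
    intro x
    have : σ * σ ∈ (Finset.univ : Finset (L ≃ₐ[K] L)) := Finset.mem_univ _
    rw [huniv, Finset.mem_insert, Finset.mem_singleton] at this
    rcases this with h | h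
    · exact DFunLike.congr_fun h x
    · exact absurd (mul_left_cancel (h.trans (mul_one σ).symm)) hσ
  have hss : ∀ x, s (s x) = x := fun x => RingOfIntegers.ext (by rw [hs, hs, hσσ])
  have hsw : s w = -w := RingOfIntegers.ext (by rw [hs, hw]; simp)
  have hsβ : β - s β = w := RingOfIntegers.ext (by simpa [hs] using hβ)
  have hsv : s v = -v := by
    have h3 : s w * s v = 1 := by rw [← map_mul, hwv, map_one]
    rw [hsw] at h3
    calc s v = s v * (w * v) := by rw [hwv, mul_one]
      _ = -v * (-w * s v) := by ring
      _ = -v := by rw [h3, mul_one]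
  have hsalg : ∀ y : 𝓞 K, s (algebraMap (𝓞 K) (𝓞 L) y) = algebraMap (𝓞 K) (𝓞 L) y := by
    intro y
    apply RingOfIntegers.ext
    rw [hs]
    exact σ.commutes (y : K)
  have hN : ∀ x : 𝓞 L, algebraMap (𝓞 K) (𝓞 L) (RingOfIntegers.norm K x) = x * s x := by
    intro x
    apply RingOfIntegers.ext
    rw [RingOfIntegers.coe_algebraMap_norm, hnormL]
    simp [hs]
  have hTr : ∀ x : 𝓞 L, ∃ y : 𝓞 K, algebraMap (𝓞 K) (𝓞 L) y = x + s x := by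
    intro x
    refine ⟨⟨Algebra.trace K L x, Algebra.isIntegral_trace x.2⟩, ?_⟩
    apply RingOfIntegers.ext
    change algebraMap K L (Algebra.trace K L x) = _
    rw [trace_eq_sum_automorphisms, huniv, Finset.sum_pair hσ.symm]
    simp [hs]
  -- units
  obtain ⟨e, heN, hee⟩ : ∃ e : (𝓞 L)ˣ, Units.map (RingOfIntegers.norm K) e = 1 ∧
      ∀ ε, e ≠ Units.map (s : 𝓞 L →* 𝓞 L) ε / ε := by
    refine hilbert94_abstract (𝓞 L)ˣ (𝓞 K)ˣ
      (Units.map (algebraMap (𝓞 K) (𝓞 L) : 𝓞 K →* 𝓞 L)) (Units.map (RingOfIntegers.norm K))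
      (Units.map (s : 𝓞 L →* 𝓞 L)) ?_ ?_ ?_ ?_ (-1) ?_ ?_ ?_ ?_
    · intro x; ext1; exact hN x
    · intro y; ext1
      change RingOfIntegers.norm K (algebraMap (𝓞 K) (𝓞 L) (y : 𝓞 K)) = (y : 𝓞 K) ^ 2
      rw [RingOfIntegers.norm_algebraMap, h2]
    · intro y; ext1; exact hsalg y
    · rw [Units.finrank_eq, Units.finrank_eq, Units.rank, Units.rank,
        IsUnramifiedAtInfinitePlaces.card_infinitePlace K L, h2]
      have : 0 < Fintype.card (InfinitePlace K) := Fintype.card_pos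
      omega
    · simp
    · intro h
      have h3 : ((-1 : (𝓞 L)ˣ) : L) = 1 := by rw [h]; simp
      have h4 : (-1 : L) = 1 := by simpa using h3
      norm_num at h4
    · ext1
      change RingOfIntegers.norm K (-1 : 𝓞 L) = 1
      apply RingOfIntegers.ext
      rw [RingOfIntegers.coe_norm]
      have : ((-1 : 𝓞 L) : L) = algebraMap K L (-1) := by simp
      rw [this, Algebra.norm_algebraMap, h2]
      simp
    · rw [Nat.card_eq_two_iff]
      refine ⟨1, ⟨-1, by simp [MonoidHom.mem_ker]⟩, ?_, ?_⟩
      · intro h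
        have h3 := congrArg (fun z : (powMonoidHom (α := (𝓞 K)ˣ) 2).ker => ((z : (𝓞 K)ˣ) : K)) h
        have h4 : (1 : K) = -1 := by simpa using h3
        norm_num at h4
      · ext ⟨x, hx⟩
        simp only [Set.mem_insert_iff, Set.mem_singleton_iff, Set.mem_univ, iff_true]
        rw [MonoidHom.mem_ker, powMonoidHom_apply] at hx
        have h3 : ((x : (𝓞 K)ˣ) : 𝓞 K) ^ 2 = 1 := by rw [← Units.val_pow_eq_pow_val, hx]; rfl
        rcases mul_self_eq_one_iff.mp ((sq _).symm.trans h3) with h | h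
        · left; exact Subtype.ext (Units.ext h)
        · right; exact Subtype.ext (Units.ext h)
  have he1 : (e : 𝓞 L) * s e = 1 := by
    rw [← hN]
    have := congrArg (fun z : (𝓞 K)ˣ => algebraMap (𝓞 K) (𝓞 L) z) heN
    simpa using this
  obtain ⟨x, hx0, hx⟩ : ∃ x : 𝓞 L, x ≠ 0 ∧ s x = e * x := by
    by_cases h : (1 : 𝓞 L) + s e = 0
    · refine ⟨w, hw0, ?_⟩
      have h3 : s e = -1 := by linear_combination h
      rw [h3] at he1
      rw [hsw]
      linear_combination w * he1
    · refine ⟨1 + s e, h, ?_⟩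
      rw [map_add, map_one, hss]
      linear_combination -he1
  let J : Ideal (𝓞 L) := Ideal.span {x}
  have hsJ : ∀ z ∈ J, s z ∈ J := by
    intro z hz
    obtain ⟨c, rfl⟩ := Ideal.mem_span_singleton'.mp hz
    rw [map_mul, hx]
    exact Ideal.mul_mem_left _ _ (Ideal.mul_mem_left _ _ (Ideal.mem_span_singleton_self x))
  let I : Ideal (𝓞 K) := Ideal.span {y | ∃ z ∈ J, algebraMap (𝓞 K) (𝓞 L) y = z + s z}
  have hIJ : I.map (algebraMap (𝓞 K) (𝓞 L)) = J := by
    apply le_antisymm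
    · rw [Ideal.map_span, Ideal.span_le]
      rintro _ ⟨y, ⟨z, hz, hy⟩, rfl⟩
      rw [SetLike.mem_coe, hy]
      exact J.add_mem hz (hsJ z hz)
    · rw [Ideal.span_le, Set.singleton_subset_iff, SetLike.mem_coe]
      have key : ∀ z ∈ J, z + s z ∈ I.map (algebraMap (𝓞 K) (𝓞 L)) := by
        intro z hz
        obtain ⟨y, hy⟩ := hTr z
        rw [← hy]
        exact Ideal.mem_map_of_mem _ (Ideal.subset_span ⟨z, hz, hy⟩)
      have hxJ : x ∈ J := Ideal.mem_span_singleton_self x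
      have k1 := key (x * v) (J.mul_mem_right _ hxJ)
      have k2 := key (x * v * s β) (J.mul_mem_right _ (J.mul_mem_right _ hxJ))
      have : x = (x * v + s (x * v)) * β - (x * v * s β + s (x * v * s β)) := by
        simp only [map_mul, hss, hsv]
        linear_combination (-x) * hwv - x * v * hsβ
      rw [this]
      exact Ideal.sub_mem _ (Ideal.mul_mem_right _ _ k1) k2
  have hJ0 : J ≠ ⊥ := by
    rw [Ne, Ideal.span_singleton_eq_bot]; exact hx0
  have hI0 : I ≠ ⊥ := by
    intro h; rw [h, Ideal.map_bot] at hIJ; exact hJ0 hIJ.symm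
  have hI2 : I ^ 2 = Ideal.span {Algebra.intNorm (𝓞 K) (𝓞 L) x} := by
    rw [← Ideal.relNorm_singleton]
    change _ = Ideal.relNorm (𝓞 K) J
    rw [← hIJ]
    rw [Ideal.relNorm_algebraMap (𝓞 L) I]
    rw [← IsFractionRing.finrank_eq (𝓞 K) K (𝓞 L) L, h2]
  refine ⟨ClassGroup.mk0 ⟨I, mem_nonZeroDivisors_of_ne_zero hI0⟩, ?_, ?_⟩
  · rw [← map_pow, ClassGroup.mk0_eq_one_iff]
    change (I ^ 2).IsPrincipal
    rw [hI2]
    exact ⟨⟨_, rfl⟩⟩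
  · intro h
    rw [ClassGroup.mk0_eq_one_iff] at h
    obtain ⟨⟨y, hy⟩⟩ := h
    change I = Ideal.span {y} at hy
    rw [hy, Ideal.map_span, Set.image_singleton] at hIJ
    have hIJ' : Ideal.span {algebraMap (𝓞 K) (𝓞 L) y} = Ideal.span {x} := hIJ
    rw [Ideal.span_singleton_eq_span_singleton] at hIJ'
    obtain ⟨ε, hε⟩ := hIJ'
    apply hee ε
    rw [eq_div_iff_mul_eq']
    ext1
    change (e : 𝓞 L) * ε = s ε
    have hy0 : algebraMap (𝓞 K) (𝓞 L) y ≠ 0 := by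
      intro h; rw [h, zero_mul] at hε; exact hx0 hε.symm
    apply mul_left_cancel₀ hy0
    rw [← hε, map_mul, hsalg] at hx
    rw [hx]; ring


theorem exists_cl2 (K : Type*) [Field K] [NumberField K] (u v α δ : 𝓞 K) (huv : u * v = 1)
    (hα : α ^ 2 - u = 4 * δ) (hpos : ∀ φ : K →+* ℝ, 0 < φ (u : K))
    (hns : ¬ IsSquare (u : K)) :
    ∃ c : ClassGroup (𝓞 K), c ^ 2 = 1 ∧ c ≠ 1 := by
  have hirr : Irreducible (X ^ 2 - C (u : K)) := by
    apply X_pow_sub_C_irreducible_of_prime Nat.prime_two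
    intro b hb
    exact hns ⟨b, by rw [← hb, sq]⟩
  have : Fact (Irreducible (X ^ 2 - C (u : K))) := ⟨hirr⟩
  let L := AdjoinRoot (X ^ 2 - C (u : K))
  let pb := AdjoinRoot.powerBasis hirr.ne_zero
  have : FiniteDimensional K L := pb.finite
  have : CharZero L := charZero_of_injective_algebraMap (algebraMap K L).injective
  have : NumberField L := NumberField.of_module_finite K L
  have h2 : Module.finrank K L = 2 := by
    rw [pb.finrank, AdjoinRoot.powerBasis_dim, natDegree_X_pow_sub_C]
  have : Algebra.IsQuadraticExtension K L := { finrank_eq_two' := h2 }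
  let w : L := AdjoinRoot.root (X ^ 2 - C (u : K))
  have hw2 : w ^ 2 = algebraMap K L u := by
    have := AdjoinRoot.eval₂_root (X ^ 2 - C (u : K))
    simp only [eval₂_sub, eval₂_X_pow, eval₂_C] at this
    exact sub_eq_zero.mp this
  have hwint : IsIntegral ℤ w := by
    apply IsIntegral.of_pow (n := 2) (by norm_num)
    rw [hw2]
    exact (RingOfIntegers.isIntegral_coe u).map ((algebraMap K L).toIntAlgHom)
  have hαK : ((α : K)) ^ 2 - u = 4 * δ := by
    have := congrArg (algebraMap (𝓞 K) K) hα
    rw [map_sub, map_pow, map_mul] at this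
    rw [show algebraMap (𝓞 K) K 4 = 4 from map_ofNat _ 4] at this
    exact this
  have hαL := congrArg (algebraMap K L) hαK
  simp only [map_sub, map_pow, map_mul, map_ofNat] at hαL
  have hβint : IsIntegral ℤ ((algebraMap K L α + w) / 2) := by
    have h3 : IsIntegral (𝓞 K) ((algebraMap K L α + w) / 2) := by
      refine ⟨X ^ 2 - C α * X + C δ, ?_, ?_⟩
      · monicity!
      · have e1 : algebraMap (𝓞 K) L α = algebraMap K L α := rfl
        have e2 : algebraMap (𝓞 K) L δ = algebraMap K L δ := rfl
        simp only [eval₂_add, eval₂_sub, eval₂_mul, eval₂_C, eval₂_X, eval₂_X_pow, e1, e2]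
        linear_combination (1/4) * hw2 - (1/4) * hαL
    exact isIntegral_trans _ h3
  let f : L →ₐ[K] L := AdjoinRoot.liftAlgHom _ (Algebra.ofId K L) (-w) (by
    simp only [eval₂_sub, eval₂_X_pow, eval₂_C]
    rw [neg_sq, hw2]
    exact sub_self _)
  have hfw : f w = -w := AdjoinRoot.liftAlgHom_root ..
  let σ : L ≃ₐ[K] L := AlgEquiv.ofBijective f (AlgHom.bijective f)
  have hσw : σ w = -w := hfw
  have : IsUnramifiedAtInfinitePlaces K L := by
    constructor
    intro p
    rw [InfinitePlace.isUnramified_iff]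
    by_contra! hc
    obtain ⟨h3, h4⟩ := hc
    rw [InfinitePlace.not_isComplex_iff_isReal] at h4
    apply h3
    rw [← InfinitePlace.mk_embedding p, InfinitePlace.comap_mk, InfinitePlace.isReal_mk_iff] at h4
    rw [← InfinitePlace.mk_embedding p, InfinitePlace.isReal_mk_iff]
    set φ := p.embedding
    have h5 : ∀ k : K, (starRingEnd ℂ) (φ (algebraMap K L k)) = φ (algebraMap K L k) := by
      intro k
      exact RingHom.congr_fun h4 k
    have h6 := hpos h4.embedding
    have h7 : ((h4.embedding (u : K) : ℝ) : ℂ) = φ (algebraMap K L u) :=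
      ComplexEmbedding.IsReal.coe_embedding_apply h4 _
    have h8 : (φ w) ^ 2 = ((h4.embedding (u : K) : ℝ) : ℂ) := by
      rw [h7, ← hw2, map_pow]
    have h9 : (starRingEnd ℂ) (φ w) = φ w := by
      set r := h4.embedding (u : K)
      have : (φ w) ^ 2 = ((Real.sqrt r : ℝ) : ℂ) ^ 2 := by
        rw [h8, ← Complex.ofReal_pow, Real.sq_sqrt h6.le]
      rcases sq_eq_sq_iff_eq_or_eq_neg.mp this with h | h
      · rw [h, Complex.conj_ofReal]
      · rw [h, map_neg, Complex.conj_ofReal]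
    change ComplexEmbedding.conjugate φ = φ
    apply AdjoinRoot.ringHom_ext
    · ext k
      exact h5 k
    · exact h9
  have huvL : algebraMap K L u * algebraMap K L v = 1 := by
    rw [← map_mul]
    have := congrArg (fun z : 𝓞 K => (z : K)) huv
    have h3 : (u : K) * v = 1 := by simpa using this
    rw [h3, map_one]
  let wO : 𝓞 L := ⟨w, hwint⟩
  let vO : 𝓞 L := wO * algebraMap (𝓞 K) (𝓞 L) v
  let bO : 𝓞 L := ⟨_, hβint⟩
  refine exists_cl2_of_ext K L σ wO vO bO hσw ?_ ?_
  · apply RingOfIntegers.ext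
    change w * (w * algebraMap K L v) = 1
    rw [← mul_assoc, ← sq, hw2, huvL]
  · change (algebraMap K L α + w) / 2 - σ ((algebraMap K L α + w) / 2) = w
    rw [map_div₀, map_add, hσw, AlgEquiv.commutes, map_ofNat]
    ring


section AdjoinFacts

lemma cubicPoly_natDegree (a b : ℤ) : (cubicPoly a b).natDegree = 3 := by
  unfold cubicPoly; compute_degree!

lemma cubicPoly_monic (a b : ℤ) : (cubicPoly a b).Monic := by
  unfold cubicPoly; monicity!

lemma cubic_root_eq (a b : ℤ) [Fact (Irreducible (cubicPoly a b))] :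
    (AdjoinRoot.root (cubicPoly a b)) ^ 3 + (a : AdjoinRoot (cubicPoly a b)) *
      (AdjoinRoot.root (cubicPoly a b)) ^ 2 + (b : AdjoinRoot (cubicPoly a b)) *
      AdjoinRoot.root (cubicPoly a b) + 1 = 0 := by
  have h := AdjoinRoot.aeval_eq (f := cubicPoly a b) (cubicPoly a b)
  rw [AdjoinRoot.mk_self] at h
  conv at h => lhs; arg 2; unfold cubicPoly
  simpa using h

lemma cubic_indep (a b : ℤ) [Fact (Irreducible (cubicPoly a b))] (c0 c1 c2 : ℚ)
    (h : (c0 : AdjoinRoot (cubicPoly a b)) + c1 * AdjoinRoot.root (cubicPoly a b) +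
      c2 * (AdjoinRoot.root (cubicPoly a b)) ^ 2 = 0) : c0 = 0 ∧ c1 = 0 ∧ c2 = 0 := by
  have h1 : AdjoinRoot.mk (cubicPoly a b) (C c0 + C c1 * X + C c2 * X ^ 2) = 0 := by
    rw [← AdjoinRoot.aeval_eq]
    simpa using h
  rw [AdjoinRoot.mk_eq_zero] at h1
  have h2 : C c0 + C c1 * X + C c2 * X ^ 2 = 0 := by
    by_contra hne
    have := natDegree_le_of_dvd h1 hne
    rw [cubicPoly_natDegree] at this
    have h3 : (C c0 + C c1 * X + C c2 * X ^ 2).natDegree ≤ 2 := by compute_degree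
    omega
  refine ⟨?_, ?_, ?_⟩
  · simpa [coeff_X, coeff_C] using congrArg (fun p => coeff p 0) h2
  · simpa [coeff_X, coeff_C, coeff_X_pow] using congrArg (fun p => coeff p 1) h2
  · simpa [coeff_X, coeff_C, coeff_X_pow] using congrArg (fun p => coeff p 2) h2

lemma cubic_span (a b : ℤ) [Fact (Irreducible (cubicPoly a b))] (z : AdjoinRoot (cubicPoly a b)) :
    ∃ c0 c1 c2 : ℚ, z = (c0 : AdjoinRoot (cubicPoly a b)) +
      c1 * AdjoinRoot.root (cubicPoly a b) +
      c2 * (AdjoinRoot.root (cubicPoly a b)) ^ 2 := by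
  obtain ⟨p, rfl⟩ := AdjoinRoot.mk_surjective z
  have hm := cubicPoly_monic a b
  have h1 : AdjoinRoot.mk (cubicPoly a b) p = AdjoinRoot.mk (cubicPoly a b) (p %ₘ cubicPoly a b) := by
    conv_lhs => rw [← modByMonic_add_div p (cubicPoly a b)]
    simp
  have hd : (p %ₘ cubicPoly a b).natDegree < 3 := by
    rw [← cubicPoly_natDegree a b]
    exact natDegree_modByMonic_lt _ hm (fun h => by
      have := cubicPoly_natDegree a b; rw [h] at this; simp at this)
  set q := p %ₘ cubicPoly a b
  refine ⟨q.coeff 0, q.coeff 1, q.coeff 2, ?_⟩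
  rw [h1, ← AdjoinRoot.aeval_eq, aeval_eq_sum_range' hd]
  simp [Finset.sum_range_succ, Algebra.smul_def]

lemma cubic_finrank (a b : ℤ) [h : Fact (Irreducible (cubicPoly a b))] :
    FiniteDimensional ℚ (AdjoinRoot (cubicPoly a b)) ∧
    Module.finrank ℚ (AdjoinRoot (cubicPoly a b)) = 3 := by
  let pb := AdjoinRoot.powerBasis h.out.ne_zero
  refine ⟨pb.finite, ?_⟩
  rw [pb.finrank, AdjoinRoot.powerBasis_dim, cubicPoly_natDegree]

lemma cubic_root_integral (a b : ℤ) [Fact (Irreducible (cubicPoly a b))] :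
    IsIntegral ℤ (AdjoinRoot.root (cubicPoly a b)) := by
  refine ⟨X ^ 3 + C a * X ^ 2 + C b * X + 1, by monicity!, ?_⟩
  have := cubic_root_eq a b
  rw [← aeval_def]
  simpa using this

end AdjoinFacts

lemma ring_exists_delta {R : Type*} [CommRing R] (a b : ℤ)
    (hmod : a % 4 = 0 ∧ b % 4 = 0 ∨ a % 4 = 1 ∧ b % 4 = 2 ∨ a % 4 = 2 ∧ b % 4 = 1)
    (θ : R) (hθ : θ ^ 3 + (a : R) * θ ^ 2 + b * θ + 1 = 0) :
    ∃ α δ : R, α ^ 2 - (-θ) = 4 * δ := by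
  rcases hmod with ⟨h3, h4⟩ | ⟨h3, h4⟩ | ⟨h3, h4⟩
  · obtain ⟨k, rfl⟩ : ∃ k, a = 4 * k := ⟨a / 4, by omega⟩
    obtain ⟨l, rfl⟩ : ∃ l, b = 4 * l := ⟨b / 4, by omega⟩
    refine ⟨θ ^ 2, -θ * (k * θ ^ 2 + l * θ), ?_⟩
    push_cast at hθ
    linear_combination θ * hθ
  · obtain ⟨k, rfl⟩ : ∃ k, a = 4 * k + 1 := ⟨a / 4, by omega⟩
    obtain ⟨l, rfl⟩ : ∃ l, b = 4 * l + 2 := ⟨b / 4, by omega⟩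
    push_cast at hθ
    refine ⟨1 - (θ ^ 2 + (4 * k + 1) * θ + (4 * l + 2)),
      -k + l * (θ ^ 2 + (4 * k + 1) * θ + (4 * l + 2)), ?_⟩
    linear_combination (θ + 4 * k + 1) * hθ
  · obtain ⟨k, rfl⟩ : ∃ k, a = 4 * k + 2 := ⟨a / 4, by omega⟩
    obtain ⟨l, rfl⟩ : ∃ l, b = 4 * l + 1 := ⟨b / 4, by omega⟩
    push_cast at hθ
    refine ⟨-θ * (-θ - 1), -θ * (k * θ ^ 2 + l * θ), ?_⟩
    linear_combination θ * hθ

lemma square_of_cl2 (a b : ℤ) (h : InBFam (a, b)) (h1 : cl2CardOfPoly (cubicPoly a b) = 1)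
    [hf : Fact (Irreducible (cubicPoly a b))] :
    IsSquare (-(AdjoinRoot.root (cubicPoly a b))) := by
  obtain ⟨ha, hb, hmod, -, -⟩ := h
  simp only [Prod.mk.injEq] at ha hb hmod
  by_contra hns
  have := (cubic_finrank a b).1
  have : CharZero (AdjoinRoot (cubicPoly a b)) :=
    charZero_of_injective_algebraMap (algebraMap ℚ (AdjoinRoot (cubicPoly a b))).injective
  have : NumberField (AdjoinRoot (cubicPoly a b)) := ⟨⟩
  have hroot := cubic_root_eq a b
  have hinteg := cubic_root_integral a b
  have key : ∃ c : ClassGroup (𝓞 (AdjoinRoot (cubicPoly a b))), c ^ 2 = 1 ∧ c ≠ 1 := by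
    let θ : 𝓞 (AdjoinRoot (cubicPoly a b)) := ⟨AdjoinRoot.root (cubicPoly a b), hinteg⟩
    have hθ : θ ^ 3 + (a : 𝓞 (AdjoinRoot (cubicPoly a b))) * θ ^ 2 + b * θ + 1 = 0 := by
      apply RingOfIntegers.ext
      have e1 : algebraMap (𝓞 (AdjoinRoot (cubicPoly a b))) (AdjoinRoot (cubicPoly a b)) θ =
        AdjoinRoot.root (cubicPoly a b) := rfl
      simp only [map_add, map_pow, map_mul, map_intCast, map_one, e1]
      rw [hroot]; rfl
    have hu : -θ * (θ ^ 2 + a * θ + b) = 1 := by linear_combination -hθ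
    have hpos : ∀ φ : AdjoinRoot (cubicPoly a b) →+* ℝ,
        0 < φ ((-θ : 𝓞 (AdjoinRoot (cubicPoly a b))) : AdjoinRoot (cubicPoly a b)) := by
      intro φ
      have e1 : ((-θ : 𝓞 (AdjoinRoot (cubicPoly a b))) : AdjoinRoot (cubicPoly a b)) =
        - AdjoinRoot.root (cubicPoly a b) := rfl
      rw [e1, map_neg]
      have h2 := congrArg φ hroot
      simp only [map_add, map_pow, map_mul, map_intCast, map_one, map_zero] at h2
      set x := φ (AdjoinRoot.root (cubicPoly a b))
      by_contra! hx
      have hx' : 0 ≤ x := by linarith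
      have ha' : (0:ℝ) < a := by exact_mod_cast ha
      have hb' : (0:ℝ) < b := by exact_mod_cast hb
      have : 0 < x ^ 3 + a * x ^ 2 + b * x + 1 := by positivity
      linarith
    obtain ⟨α, δ, hαδ⟩ := ring_exists_delta a b hmod θ hθ
    exact exists_cl2 _ (-θ) _ α δ hu hαδ hpos hns
  obtain ⟨c, hc, hc1⟩ := key
  unfold cl2CardOfPoly at h1
  rw [dif_pos hf.out] at h1
  obtain ⟨hsub, -⟩ := Nat.card_eq_one_iff_unique.mp h1
  have := hsub.elim ⟨c, hc⟩ ⟨1, one_pow 2⟩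
  exact hc1 (congrArg Subtype.val this)

lemma param_of_square (a b : ℤ) [hf : Fact (Irreducible (cubicPoly a b))]
    (hs : IsSquare (-(AdjoinRoot.root (cubicPoly a b)))) :
    ∃ s t n : ℤ, n ^ 2 = 1 ∧ a = s ^ 2 - 2 * t ∧ b = t ^ 2 - 2 * s * n := by
  obtain ⟨α, hα⟩ := hs
  have hroot := cubic_root_eq a b
  have hinteg := cubic_root_integral a b
  have hind := cubic_indep a b
  obtain ⟨hfd, hrk⟩ := cubic_finrank a b
  have hαi : IsIntegral ℤ α := by
    apply IsIntegral.of_pow (n := 2) (by norm_num)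
    rw [sq, ← hα]; exact hinteg.neg
  set P := minpoly ℤ α with hP
  have hmon : P.Monic := minpoly.monic hαi
  have hdeg : P.natDegree ≤ 3 := by
    have h1 := minpoly.natDegree_le (A := ℚ) α
    rw [hrk, minpoly.isIntegrallyClosed_eq_field_fractions' ℚ hαi,
      (minpoly.monic hαi).natDegree_map] at h1
    exact h1
  have hev : aeval α P = 0 := minpoly.aeval ℤ α
  rw [aeval_eq_sum_range' (n := 4) (by omega)] at hev
  simp only [Finset.sum_range_succ, Finset.sum_range_zero, zsmul_eq_mul, pow_zero, pow_one, mul_one,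
    zero_add] at hev
  set θ := AdjoinRoot.root (cubicPoly a b)
  have h3 : P.natDegree = 3 := by
    by_contra hne
    have c3 : P.coeff 3 = 0 := coeff_eq_zero_of_natDegree_lt (by omega)
    rw [c3] at hev
    have h4 := hind (((P.coeff 0) ^ 2 : ℤ)) ((- 2 * P.coeff 0 * P.coeff 2 + P.coeff 1 ^ 2 : ℤ))
      (((P.coeff 2) ^ 2 : ℤ)) (by
        push_cast at hev ⊢
        linear_combination (P.coeff 0 + P.coeff 2 * α ^ 2 - P.coeff 1 * α) * hev
          + (- 2 * P.coeff 0 * P.coeff 2 + P.coeff 1 ^ 2 - P.coeff 2 ^ 2 * (-θ + α * α)) * -hα)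
    obtain ⟨e0, e1, e2⟩ := h4
    have f0 : P.coeff 0 = 0 := by
      have : (P.coeff 0) ^ 2 = 0 := by exact_mod_cast e0
      exact pow_eq_zero_iff (by norm_num) |>.mp this
    have f2 : P.coeff 2 = 0 := by
      have : (P.coeff 2) ^ 2 = 0 := by exact_mod_cast e2
      exact pow_eq_zero_iff (by norm_num) |>.mp this
    have f1 : P.coeff 1 = 0 := by
      have : - 2 * P.coeff 0 * P.coeff 2 + P.coeff 1 ^ 2 = 0 := by exact_mod_cast e1
      rw [f0] at this
      have : (P.coeff 1) ^ 2 = 0 := by linarith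
      exact pow_eq_zero_iff (by norm_num) |>.mp this
    have : P = 0 := by
      ext i
      rcases i with _ | _ | _ | i
      · simpa using f0
      · simpa using f1
      · simpa using f2
      · simpa using coeff_eq_zero_of_natDegree_lt (by omega)
    exact hmon.ne_zero this
  have c3 : P.coeff 3 = 1 := by
    rw [← h3]; exact hmon
  rw [c3] at hev
  set n := P.coeff 0
  set t := P.coeff 1
  set s := P.coeff 2
  have h4 := hind ((1 - n ^ 2 : ℤ)) ((b - t ^ 2 + 2 * s * n : ℤ)) ((a + 2 * t - s ^ 2 : ℤ)) (by
    push_cast at hev ⊢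
    have hθ : θ = -(α * α) := by rw [← hα]; ring
    rw [hθ] at hroot ⊢
    linear_combination hroot + (α ^ 3 + t * α - s * α ^ 2 - n) * hev)
  obtain ⟨e0, e1, e2⟩ := h4
  norm_cast at e0 e1 e2
  exact ⟨s, t, n, by linarith, by linarith, by linarith⟩


lemma fam_finite (X : ℝ) : {p : ℤ × ℤ | InBFam p ∧ (max p.1 p.2 : ℝ) ≤ X}.Finite := by
  apply Set.Finite.subset ((Set.finite_Icc (0:ℤ) ⌊X⌋).prod (Set.finite_Icc (0:ℤ) ⌊X⌋))
  rintro ⟨a, b⟩ ⟨⟨ha, hb, -⟩, hX⟩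
  simp only [max_le_iff] at hX ha hb
  exact ⟨⟨ha.le, Int.le_floor.mpr hX.1⟩, ⟨hb.le, Int.le_floor.mpr hX.2⟩⟩

lemma EB_le (X : ℝ) (hX : 1 ≤ X) : (EB X : ℝ) ≤ 98 * X := by
  set N := ⌊X⌋₊ with hN
  have hN1 : 1 ≤ N := Nat.le_floor (by simpa using hX)
  set M : ℤ := (Nat.sqrt N : ℤ) + 2 with hM
  let S : Finset (ℤ × ℤ × ℤ) :=
    Finset.Icc (-M) M ×ˢ (Finset.Icc (-M) M ×ˢ ({1, -1} : Finset ℤ))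
  let g : ℤ × ℤ × ℤ → ℤ × ℤ := fun q => (q.1 ^ 2 - 2 * q.2.1, q.2.1 ^ 2 - 2 * q.1 * q.2.2)
  have hsub : {p : ℤ × ℤ | InBFam p ∧ (max p.1 p.2 : ℝ) ≤ X ∧
      cl2CardOfPoly (cubicPoly p.1 p.2) = 1} ⊆ (↑(S.image g) : Set (ℤ × ℤ)) := by
    rintro ⟨a, b⟩ ⟨hfam, hmax, hcl⟩
    simp only [max_le_iff] at hmax hcl
    have : Fact (Irreducible (cubicPoly a b)) := ⟨hfam.2.2.2.1⟩
    obtain ⟨s, t, n, hn, ha, hb⟩ := param_of_square a b (square_of_cl2 a b hfam hcl)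
    have haN : a ≤ N := by
      have h1 : a ≤ ⌊X⌋ := Int.le_floor.mpr hmax.1
      have := Int.floor_toNat X
      omega
    have hbN : b ≤ N := by
      have h1 : b ≤ ⌊X⌋ := Int.le_floor.mpr hmax.2
      have := Int.floor_toNat X
      omega
    have hn' : n = 1 ∨ n = -1 := mul_self_eq_one_iff.mp (by rw [← sq]; exact hn)
    have hsq : (N : ℤ) < ((Nat.sqrt N : ℤ) + 1) ^ 2 := by
      have := Nat.lt_succ_sqrt N
      rw [Nat.succ_eq_add_one] at this
      zify at this
      nlinarith
    have key : |s| ≤ M ∧ |t| ≤ M := by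
      have h1 : |s| ^ 2 ≤ N + 2 * |t| := by
        rw [sq_abs]; have := le_abs_self t; linarith
      have h2 : |t| ^ 2 ≤ N + 2 * |s| := by
        rw [sq_abs]
        rcases hn' with rfl | rfl
        · have := le_abs_self s; linarith
        · have := neg_abs_le s; linarith
      have hr : (0:ℤ) ≤ Nat.sqrt N := by positivity
      have h3 := abs_nonneg s
      have h4 := abs_nonneg t
      rcases le_total |s| |t| with h | h
      · have : |t| ≤ M := by
          by_contra! hc
          rw [hM] at hc
          nlinarith
        exact ⟨h.trans this, this⟩
      · have : |s| ≤ M := by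
          by_contra! hc
          rw [hM] at hc
          nlinarith
        exact ⟨this, h.trans this⟩
    rw [abs_le, abs_le] at key
    simp only [Finset.coe_image, Set.mem_image, Finset.mem_coe]
    refine ⟨(s, t, n), ?_, ?_⟩
    · simp only [S, Finset.mem_product, Finset.mem_Icc, Finset.mem_insert, Finset.mem_singleton]
      exact ⟨key.1, key.2, hn'⟩
    · simp only [g, Prod.mk.injEq]
      exact ⟨ha.symm, hb.symm⟩
  have h1 : EB X ≤ S.card := by
    unfold EB
    rw [Nat.card_coe_set_eq]
    calc _ ≤ (↑(S.image g) : Set (ℤ × ℤ)).ncard := Set.ncard_le_ncard hsub (Finset.finite_toSet _)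
      _ = (S.image g).card := Set.ncard_coe_finset _
      _ ≤ S.card := Finset.card_image_le
  have h2 : S.card = (2 * Nat.sqrt N + 5) * ((2 * Nat.sqrt N + 5) * 2) := by
    simp only [S, Finset.card_product, Int.card_Icc]
    have : (M + 1 - -M).toNat = 2 * Nat.sqrt N + 5 := by omega
    rw [this]; rfl
  have h3 : Nat.sqrt N * Nat.sqrt N ≤ N := Nat.sqrt_le N
  have h4 : Nat.sqrt N ≤ N := Nat.sqrt_le_self N
  have h5 : EB X ≤ 98 * N := by nlinarith
  have h6 : (N : ℝ) ≤ X := Nat.floor_le (by linarith)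
  have h7 : (EB X : ℝ) ≤ 98 * N := by exact_mod_cast h5
  linarith


section Maximality

variable {K : Type*} [Field K] [CharZero K]

lemma int_of_rat_integral (q : ℚ) (h : IsIntegral ℤ (q : K)) : ∃ n : ℤ, q = n := by
  have h1 : IsIntegral ℤ q := by
    rw [← isIntegral_algebraMap_iff (R := ℤ) (B := K) (algebraMap ℚ K).injective]
    simpa using h
  obtain ⟨n, hn⟩ := IsIntegrallyClosed.isIntegral_iff.mp h1
  exact ⟨n, by simpa using hn.symm⟩

lemma int_cubic (hK : Module.finrank ℚ K = 3) (y : K) (hy : IsIntegral ℤ y)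
    (hy' : ∀ q : ℚ, y ≠ q) (E2 E1 E0 : ℚ)
    (h : y ^ 3 + E2 * y ^ 2 + E1 * y + E0 = 0) :
    ∃ e2 e1 e0 : ℤ, E2 = e2 ∧ E1 = e1 ∧ E0 = e0 := by
  have hfd : FiniteDimensional ℚ K := Module.finite_of_finrank_pos (by omega)
  have hyQ : IsIntegral ℚ y := hy.tower_top
  have h3 : (minpoly ℚ y).natDegree = 3 := by
    have h1 := minpoly.degree_dvd hyQ
    rw [hK] at h1
    rcases (Nat.dvd_prime Nat.prime_three).mp h1 with h2 | h2
    · exfalso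
      rw [minpoly.natDegree_eq_one_iff] at h2
      obtain ⟨q, hq⟩ := h2
      exact hy' q (by rw [← hq]; simp)
    · exact h2
  have hm : (X ^ 3 + C E2 * X ^ 2 + C E1 * X + C E0).Monic := by monicity!
  have hd : (X ^ 3 + C E2 * X ^ 2 + C E1 * X + C E0).natDegree = 3 := by compute_degree!
  have heq : minpoly ℚ y = X ^ 3 + C E2 * X ^ 2 + C E1 * X + C E0 := by
    refine (eq_of_monic_of_dvd_of_natDegree_le (minpoly.monic hyQ) hm ?_ ?_).symm
    · apply minpoly.dvd
      simpa using h
    · rw [hd, h3]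
  rw [minpoly.isIntegrallyClosed_eq_field_fractions' ℚ hy] at heq
  refine ⟨(minpoly ℤ y).coeff 2, (minpoly ℤ y).coeff 1, (minpoly ℤ y).coeff 0, ?_, ?_, ?_⟩
  · have := congrArg (fun p => coeff p 2) heq
    simpa [coeff_X, coeff_C, coeff_X_pow] using this.symm
  · have := congrArg (fun p => coeff p 1) heq
    simpa [coeff_X, coeff_C, coeff_X_pow] using this.symm
  · have := congrArg (fun p => coeff p 0) heq
    simpa [coeff_X, coeff_C, coeff_X_pow] using this.symm

variable (hK : Module.finrank ℚ K = 3) (a b : ℤ) (θ : K)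
  (hroot : θ ^ 3 + (a : K) * θ ^ 2 + b * θ + 1 = 0) (hinteg : IsIntegral ℤ θ)
  (hind : ∀ c0 c1 c2 : ℚ, (c0 : K) + c1 * θ + c2 * θ ^ 2 = 0 → c0 = 0 ∧ c1 = 0 ∧ c2 = 0)
  (p : ℕ) (hp : p.Prime)
  (hH : ∀ r : ℤ, ¬ ((p : ℤ) ^ 2 ∣ r ^ 3 + a * r ^ 2 + b * r + 1 ∧
    (p : ℤ) ∣ 3 * r ^ 2 + 2 * a * r + b))

include hK hroot hind hp hinteg hH in
lemma max_linear (y : K) (hy : IsIntegral ℤ y) (n0 n1 : ℤ) (h : p * y = n0 + n1 * θ) :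
    (p : ℤ) ∣ n0 ∧ (p : ℤ) ∣ n1 := by
  have hp0 : (p : K) ≠ 0 := by exact_mod_cast hp.ne_zero
  have hpQ : (p : ℚ) ≠ 0 := by exact_mod_cast hp.ne_zero
  have hn1 : (p : ℤ) ∣ n1 := by
    by_contra hn
    have hcop : IsCoprime (p : ℤ) n1 := (Nat.prime_iff_prime_int.mp hp).coprime_iff_not_dvd.mpr hn
    obtain ⟨k, m, hkm⟩ := hcop
    have hkmK : (k : K) * p + m * n1 = 1 := by exact_mod_cast hkm
    set r : ℤ := -(m * n0) with hr
    have hyint : IsIntegral ℤ ((θ - r) / p : K) := by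
      have e : (θ - r) / p = (m : K) * y + k * θ := by
        rw [hr]; field_simp; push_cast
        linear_combination -θ * hkmK - m * h
      rw [e]
      exact ((isIntegral_intCast _).mul hy).add ((isIntegral_intCast _).mul hinteg)
    obtain ⟨e2, e1, e0, h2, h1, h0⟩ := int_cubic hK _ hyint (by
        intro q hq
        rw [div_eq_iff hp0] at hq
        have := hind (-r - q * p) 1 0 (by push_cast; linear_combination hq)
        simp at this)
      ((3 * r + a) / p) ((3 * r ^ 2 + 2 * a * r + b) / p ^ 2)
      ((r ^ 3 + a * r ^ 2 + b * r + 1) / p ^ 3) (by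
        push_cast
        field_simp
        linear_combination hroot)
    rw [div_eq_iff (by positivity)] at h1 h0
    apply hH r
    constructor
    · refine ⟨e0 * p, ?_⟩
      have : r ^ 3 + a * r ^ 2 + b * r + 1 = e0 * (p : ℤ) ^ 3 := by exact_mod_cast h0
      rw [this]; ring
    · refine ⟨e1 * p, ?_⟩
      have : 3 * r ^ 2 + 2 * a * r + b = e1 * (p : ℤ) ^ 2 := by exact_mod_cast h1
      rw [this]; ring
  refine ⟨?_, hn1⟩
  obtain ⟨k, hk⟩ := hn1
  obtain ⟨n, hn⟩ := int_of_rat_integral (K := K) ((n0 : ℚ) / p) (by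
    have e : (((n0 : ℚ) / p : ℚ) : K) = y - k * θ := by
      push_cast
      rw [hk] at h
      push_cast at h
      field_simp
      linear_combination -h
    rw [e]
    exact hy.sub ((isIntegral_intCast _).mul hinteg))
  refine ⟨n, ?_⟩
  rw [div_eq_iff hpQ] at hn
  have : n0 = n * p := by exact_mod_cast hn
  rw [this]; ring

include hK hroot hind hp in
lemma max_norm (w : K) (hw : IsIntegral ℤ w) (s r : ℤ) (h : p * w = (θ - s) * (θ - r)) :
    (p : ℤ) ^ 3 ∣ (s ^ 3 + a * s ^ 2 + b * s + 1) * (r ^ 3 + a * r ^ 2 + b * r + 1) := by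
  have hp0 : (p : K) ≠ 0 := by exact_mod_cast hp.ne_zero
  have hpQ : (p : ℚ) ≠ 0 := by exact_mod_cast hp.ne_zero
  set A : ℤ := 3 * s + a with hA
  set B : ℤ := 3 * s ^ 2 + 2 * a * s + b with hB
  set C : ℤ := s ^ 3 + a * s ^ 2 + b * s + 1 with hC
  set d : ℤ := r - s with hd
  have hF : (θ - s) ^ 3 + A * (θ - s) ^ 2 + B * (θ - s) + C = 0 := by
    rw [hA, hB, hC]; push_cast; linear_combination hroot
  set φ : K := θ - s with hφ
  have h' : p * w = φ ^ 2 - d * φ := by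
    rw [h, hd, hφ]; push_cast; ring
  obtain ⟨e2, e1, e0, h2, h1, h0⟩ := int_cubic hK w hw (by
      intro q hq
      have := hind (s * r - q * p) (-(s + r)) 1 (by
        rw [hq] at h
        push_cast; linear_combination -h)
      simp at this)
    (-(A ^ 2 - 2 * B + d * A) / p) ((B ^ 2 - 2 * A * C + d * (A * B - 3 * C) + d ^ 2 * B) / p ^ 2)
    (-(C * (d ^ 3 + A * d ^ 2 + B * d + C)) / p ^ 3) (by
      have hw' : w = (φ ^ 2 - d * φ) / p := by field_simp; linear_combination h'
      rw [hw']
      push_cast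
      field_simp
      linear_combination -((d - φ) ^ 3 + A * (d - φ) ^ 2 + B * (d - φ) + C) * hF)
  rw [div_eq_iff (by positivity)] at h0
  have h3 : -(C * (d ^ 3 + A * d ^ 2 + B * d + C)) = e0 * (p : ℤ) ^ 3 := by exact_mod_cast h0
  refine ⟨-e0, ?_⟩
  rw [show r = d + s by rw [hd]; ring]
  rw [hA, hB] at h3
  linear_combination -h3 - C * hC

include hK hroot hind hp in
lemma max_trace (w : K) (hw : IsIntegral ℤ w) (c0 c1 : ℤ) (h : p * w = θ ^ 2 + c1 * θ + c0) :
    (p : ℤ) ∣ a ^ 2 - 2 * b - c1 * a + 3 * c0 := by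
  have hp0 : (p : K) ≠ 0 := by exact_mod_cast hp.ne_zero
  have hpQ : (p : ℚ) ≠ 0 := by exact_mod_cast hp.ne_zero
  set d : ℤ := -c1 with hd
  set G2 : ℤ := -(a ^ 2 - 2 * b + d * a) with hG2
  set G1 : ℤ := b ^ 2 - 2 * a + d * (a * b - 3) + d ^ 2 * b with hG1
  set G0 : ℤ := -(d ^ 3 + a * d ^ 2 + b * d + 1) with hG0
  have hG : (θ ^ 2 - d * θ) ^ 3 + G2 * (θ ^ 2 - d * θ) ^ 2 + G1 * (θ ^ 2 - d * θ) + G0 = 0 := by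
    rw [hG2, hG1, hG0]; push_cast
    linear_combination -((d - θ) ^ 3 + a * (d - θ) ^ 2 + b * (d - θ) + 1) * hroot
  have hw1 : θ ^ 2 - d * θ = p * w - c0 := by rw [h, hd]; push_cast; ring
  rw [hw1] at hG
  obtain ⟨e2, e1, e0, h2, h1, h0⟩ := int_cubic hK w hw (by
      intro q hq
      have := hind (c0 - q * p) c1 1 (by
        rw [hq] at h
        push_cast; linear_combination -h)
      simp at this)
    ((G2 - 3 * c0) / p) ((3 * c0 ^ 2 - 2 * c0 * G2 + G1) / p ^ 2)
    ((-c0 ^ 3 + G2 * c0 ^ 2 - G1 * c0 + G0) / p ^ 3) (by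
      push_cast
      field_simp
      linear_combination hG)
  rw [div_eq_iff hpQ] at h2
  have h3 : G2 - 3 * c0 = e2 * (p : ℤ) := by exact_mod_cast h2
  refine ⟨-e2, ?_⟩
  rw [hG2, hd] at h3
  linear_combination -h3

include hK hroot hind hp hinteg hH in
lemma max_key (y : K) (hy : IsIntegral ℤ y) (n0 n1 n2 : ℤ)
    (h : p * y = n0 + n1 * θ + n2 * θ ^ 2) :
    (p : ℤ) ∣ n0 ∧ (p : ℤ) ∣ n1 ∧ (p : ℤ) ∣ n2 := by
  have hp0 : (p : K) ≠ 0 := by exact_mod_cast hp.ne_zero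
  have hpp : Prime (p : ℤ) := Nat.prime_iff_prime_int.mp hp
  have hpz : (p : ℤ) ≠ 0 := hpp.ne_zero
  have hn2 : (p : ℤ) ∣ n2 := by
    by_contra hn
    have hcop : IsCoprime (p : ℤ) n2 := hpp.coprime_iff_not_dvd.mpr hn
    obtain ⟨k, m, hkm⟩ := hcop
    have hkmK : (k : K) * p + m * n2 = 1 := by exact_mod_cast hkm
    obtain ⟨c1, hc1⟩ : ∃ c1 : ℤ, c1 = m * n1 := ⟨_, rfl⟩
    obtain ⟨c0, hc0⟩ : ∃ c0 : ℤ, c0 = m * n0 := ⟨_, rfl⟩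
    have hc1K : (c1 : K) = m * n1 := by exact_mod_cast hc1
    have hc0K : (c0 : K) = m * n0 := by exact_mod_cast hc0
    obtain ⟨y1, hy1⟩ : ∃ y1 : K, y1 = m * y + k * θ ^ 2 := ⟨_, rfl⟩
    have hi1 : IsIntegral ℤ y1 := by
      rw [hy1]; exact ((isIntegral_intCast _).mul hy).add ((isIntegral_intCast _).mul (hinteg.pow 2))
    have hq : p * y1 = θ ^ 2 + c1 * θ + c0 := by
      rw [hy1, hc1K, hc0K]
      linear_combination m * h + θ ^ 2 * hkmK
    obtain ⟨d0, d1⟩ := max_linear hK a b θ hroot hinteg hind p hp hH (θ * y1 - (c1 - a : ℤ) * y1)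
      ((hinteg.mul hi1).sub ((isIntegral_intCast _).mul hi1)) (-1 - (c1 - a) * c0)
      (c0 - b - (c1 - a) * c1) (by
        push_cast
        linear_combination (θ - (c1 - a)) * hq + hroot)
    have dt := max_trace hK a b θ hroot hind p hp y1 hi1 c0 c1 hq
    obtain ⟨s, hs⟩ : ∃ s : ℤ, s = c1 - a := ⟨_, rfl⟩
    obtain ⟨s', hs'⟩ : ∃ s' : ℤ, s' = -c1 - s := ⟨_, rfl⟩
    obtain ⟨k0, hk0⟩ := d0
    obtain ⟨k1, hk1⟩ := d1
    obtain ⟨kt, hkt⟩ := dt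
    have hqs : ∃ e, c0 = s * s' + p * e := by
      refine ⟨kt - 2 * k1, ?_⟩
      subst hs' hs
      linear_combination hkt - 2 * hk1
    obtain ⟨e, he⟩ := hqs
    have hcc1 : c1 = -s - s' := by rw [hs']; ring
    have haa : a = -2 * s - s' := by rw [hs'] ; linear_combination hs
    obtain ⟨B, hB⟩ : ∃ B, b = s ^ 2 + 2 * s * s' + p * B := by
      refine ⟨e - k1, ?_⟩
      rw [hcc1, haa] at hk1
      linear_combination -hk1 + he
    obtain ⟨C, hC⟩ : ∃ C, 1 = -(s ^ 2 * s') + p * C := by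
      refine ⟨-k0 - s * e, ?_⟩
      rw [← hs] at hk0
      linear_combination -hk0 - s * he
    obtain ⟨y2, hy2⟩ : ∃ y2 : K, y2 = y1 - e := ⟨_, rfl⟩
    have hi2 : IsIntegral ℤ y2 := by
      rw [hy2]; exact hi1.sub (isIntegral_intCast _)
    have hq2 : p * y2 = (θ - s) * (θ - s') := by
      have he' : (c0 : K) = s * s' + p * e := by exact_mod_cast he
      have hc' : (c1 : K) = -s - s' := by exact_mod_cast hcc1
      rw [hy2]
      linear_combination hq + he' + θ * hc'
    have N1 := max_norm hK a b θ hroot hind p hp y2 hi2 s s' hq2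
    have N2 := max_norm hK a b θ hroot hind p hp (y2 - (θ - s))
      (hi2.sub (hinteg.sub (isIntegral_intCast _))) s (s' + p) (by
        push_cast
        linear_combination hq2)
    have f1 : s ^ 3 + a * s ^ 2 + b * s + 1 = p * (B * s + C) := by
      rw [hB, haa]; linear_combination hC
    have f2 : s' ^ 3 + a * s' ^ 2 + b * s' + 1 = p * (B * s' + C) := by
      rw [hB, haa]; linear_combination hC
    have f3 : (s' + p) ^ 3 + a * (s' + p) ^ 2 + b * (s' + p) + 1 =
        p * ((s' - s + p) ^ 2 + B * (s' + p) + C) := by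
      rw [hB, haa]; linear_combination hC
    have hnd : ¬ (p : ℤ) ∣ B * s + C := by
      intro hd
      apply hH s
      constructor
      · rw [f1, sq]; exact mul_dvd_mul_left _ hd
      · exact ⟨B, by rw [hB, haa]; ring⟩
    rw [f1, f2] at N1
    rw [f1, f3] at N2
    have g1 : (p : ℤ) ∣ B * s' + C := by
      obtain ⟨c, hc⟩ := N1
      have : (B * s + C) * (B * s' + C) = p * c := by
        apply mul_left_cancel₀ (pow_ne_zero 2 hpz)
        linear_combination hc
      exact (hpp.dvd_or_dvd ⟨c, this⟩).resolve_left hnd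
    have g2 : (p : ℤ) ∣ (s' - s + p) ^ 2 + B * (s' + p) + C := by
      obtain ⟨c, hc⟩ := N2
      have : (B * s + C) * ((s' - s + p) ^ 2 + B * (s' + p) + C) = p * c := by
        apply mul_left_cancel₀ (pow_ne_zero 2 hpz)
        linear_combination hc
      exact (hpp.dvd_or_dvd ⟨c, this⟩).resolve_left hnd
    obtain ⟨i1, hi1'⟩ := g1
    obtain ⟨i2, hi2'⟩ := g2
    have g3 : (p : ℤ) ∣ (s' - s) ^ 2 :=
      ⟨i2 - i1 - 2 * (s' - s) - p - B, by linear_combination hi2' - hi1'⟩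
    obtain ⟨i3, hi3⟩ := hpp.dvd_of_dvd_pow g3
    exact hnd ⟨i1 - B * i3, by linear_combination hi1' - B * hi3⟩
  obtain ⟨k, hk⟩ := hn2
  have hkK : (n2 : K) = p * k := by exact_mod_cast hk
  obtain ⟨d0, d1⟩ := max_linear hK a b θ hroot hinteg hind p hp hH (y - k * θ ^ 2)
    (hy.sub ((isIntegral_intCast _).mul (hinteg.pow 2))) n0 n1 (by
      linear_combination h + θ ^ 2 * hkK)
  exact ⟨d0, d1, ⟨k, hk⟩⟩

end Maximality

lemma maximal_of (a b : ℤ) (hf : Irreducible (cubicPoly a b))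
    (hH : ∀ p : ℕ, p.Prime → ∀ r : ℤ, ¬ ((p : ℤ) ^ 2 ∣ r ^ 3 + a * r ^ 2 + b * r + 1 ∧
    (p : ℤ) ∣ 3 * r ^ 2 + 2 * a * r + b)) : IsMaximalPoly (cubicPoly a b) := by
  have : Fact (Irreducible (cubicPoly a b)) := ⟨hf⟩
  have : CharZero (AdjoinRoot (cubicPoly a b)) :=
    charZero_of_injective_algebraMap (algebraMap ℚ (AdjoinRoot (cubicPoly a b))).injective
  have hinteg := cubic_root_integral a b
  have main : ∀ D : ℕ, 0 < D → ∀ z : AdjoinRoot (cubicPoly a b), IsIntegral ℤ z →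
      ∀ n0 n1 n2 : ℤ, D * z = n0 + n1 * AdjoinRoot.root (cubicPoly a b) +
        n2 * (AdjoinRoot.root (cubicPoly a b)) ^ 2 →
      z ∈ Algebra.adjoin ℤ {AdjoinRoot.root (cubicPoly a b)} := by
    intro D
    induction D using Nat.strong_induction_on with
    | _ D ih =>
      intro hD z hz n0 n1 n2 h
      by_cases hD1 : D = 1
      · rw [hD1, Nat.cast_one, one_mul] at h
        rw [h]
        have hr : AdjoinRoot.root (cubicPoly a b) ∈
          Algebra.adjoin ℤ {AdjoinRoot.root (cubicPoly a b)} := Algebra.self_mem_adjoin_singleton _ _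
        exact add_mem (add_mem (intCast_mem _ _) (mul_mem (intCast_mem _ _) hr))
          (mul_mem (intCast_mem _ _) (pow_mem hr 2))
      · obtain ⟨p, hp, D', rfl⟩ := Nat.exists_prime_and_dvd hD1
        have hp0 : (p : AdjoinRoot (cubicPoly a b)) ≠ 0 := by exact_mod_cast hp.ne_zero
        obtain ⟨⟨k0, h0⟩, ⟨k1, h1⟩, ⟨k2, h2⟩⟩ := max_key (cubic_finrank a b).2 a b _
          (cubic_root_eq a b) hinteg (cubic_indep a b) p hp (hH p hp) (D' * z)
          ((isIntegral_natCast D').mul hz) n0 n1 n2 (by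
            rw [← h]; push_cast; ring)
        have hD' : 0 < D' := Nat.pos_of_mul_pos_left hD
        refine ih D' ?_ hD' z hz k0 k1 k2 ?_
        · nlinarith [hp.two_le]
        · apply mul_left_cancel₀ hp0
          rw [h0, h1, h2] at h
          push_cast at h
          linear_combination h
  unfold IsMaximalPoly
  apply le_antisymm
  · apply Algebra.adjoin_le
    rintro _ rfl
    exact hinteg
  · intro z hz
    obtain ⟨c0, c1, c2, hc⟩ := cubic_span a b z
    refine main (c0.den * c1.den * c2.den) (by positivity) z hz (c0.num * c1.den * c2.den)
      (c1.num * c0.den * c2.den) (c2.num * c0.den * c1.den) ?_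
    have e0 : (c0 : AdjoinRoot (cubicPoly a b)) * c0.den = c0.num := by
      exact_mod_cast congrArg (fun q : ℚ => (q : AdjoinRoot (cubicPoly a b))) (Rat.mul_den_eq_num c0)
    have e1 : (c1 : AdjoinRoot (cubicPoly a b)) * c1.den = c1.num := by
      exact_mod_cast congrArg (fun q : ℚ => (q : AdjoinRoot (cubicPoly a b))) (Rat.mul_den_eq_num c1)
    have e2 : (c2 : AdjoinRoot (cubicPoly a b)) * c2.den = c2.num := by
      exact_mod_cast congrArg (fun q : ℚ => (q : AdjoinRoot (cubicPoly a b))) (Rat.mul_den_eq_num c2)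
    rw [hc]
    push_cast
    rw [← e0, ← e1, ← e2]
    ring


/-- failure at `p` of the Dedekind criterion for `y³ + t ((n+1) y - 1) (y - 1)` -/
def badAt (n t : ℤ) (p : ℕ) : Prop :=
  ∃ y : ℤ, (p : ℤ) ^ 2 ∣ y ^ 3 + t * ((n + 1) * y ^ 2 - (n + 2) * y + 1) ∧
    (p : ℤ) ∣ 3 * y ^ 2 + t * (2 * (n + 1) * y - (n + 2))

lemma badAt_ge (j s p : ℕ) (hp : p.Prime) (h : badAt (12 * j + 1) (12 * s + 7) p) : 5 ≤ p := by
  obtain ⟨y, h1, -⟩ := h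
  have h1' : (p : ℤ) ∣ y ^ 3 + (12 * s + 7) * ((12 * j + 1 + 1) * y ^ 2 - (12 * j + 1 + 2) * y + 1) :=
    (dvd_pow_self _ (by norm_num)).trans h1
  by_contra! hlt
  rw [← ZMod.intCast_zmod_eq_zero_iff_dvd] at h1'
  push_cast at h1'
  have h2 : ∀ (y J S : ZMod 2),
    y ^ 3 + (12 * S + 7) * ((12 * J + 1 + 1) * y ^ 2 - (12 * J + 1 + 2) * y + 1) ≠ 0 := by decide
  have h3 : ∀ (y J S : ZMod 3),
    y ^ 3 + (12 * S + 7) * ((12 * J + 1 + 1) * y ^ 2 - (12 * J + 1 + 2) * y + 1) ≠ 0 := by decide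
  interval_cases p
  · exact absurd hp (by norm_num)
  · exact absurd hp (by norm_num)
  · exact h2 _ _ _ h1'
  · exact h3 _ _ _ h1'
  · exact absurd hp (by norm_num)

section Bad
variable (n t : ℤ) (p : ℕ) (hp : p.Prime)

include hp in
lemma bad_dvd_t (h : badAt n t p) (ht : (p : ℤ) ∣ t) : (p : ℤ) ^ 2 ∣ t := by
  obtain ⟨y, h1, -⟩ := h
  have hpp : Prime (p : ℤ) := Nat.prime_iff_prime_int.mp hp
  have h1' : (p : ℤ) ∣ y ^ 3 + t * ((n + 1) * y ^ 2 - (n + 2) * y + 1) :=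
    (dvd_pow_self _ (by norm_num)).trans h1
  have hy : (p : ℤ) ∣ y :=
    hpp.dvd_of_dvd_pow ((dvd_add_left (ht.mul_right _)).mp h1')
  have hy3 : (p : ℤ) ^ 2 ∣ y ^ 3 :=
    (pow_dvd_pow_of_dvd hy 2).trans (pow_dvd_pow y (by norm_num))
  have h3 := (dvd_add_right hy3).mp h1
  refine (IsCoprime.pow_left ?_).dvd_of_dvd_mul_right h3
  obtain ⟨k, rfl⟩ := hy
  exact ⟨-((n + 1) * p * k ^ 2 - (n + 2) * k), 1, by ring⟩

include hp in
lemma bad_root (y : ℤ) (h1 : (p : ℤ) ^ 2 ∣ y ^ 3 + t * ((n + 1) * y ^ 2 - (n + 2) * y + 1))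
    (h2 : (p : ℤ) ∣ 3 * y ^ 2 + t * (2 * (n + 1) * y - (n + 2))) (ht : ¬ (p : ℤ) ∣ t) :
    (p : ℤ) ∣ (n + 1) * y ^ 2 - 2 * (n + 2) * y + 3 := by
  have hpp : Prime (p : ℤ) := Nat.prime_iff_prime_int.mp hp
  have h1' : (p : ℤ) ∣ y ^ 3 + t * ((n + 1) * y ^ 2 - (n + 2) * y + 1) :=
    (dvd_pow_self _ (by norm_num)).trans h1
  obtain ⟨k, hk⟩ := h1'
  obtain ⟨l, hl⟩ := h2
  refine (hpp.dvd_or_dvd (a := t) ⟨3 * k - y * l, ?_⟩).resolve_left ht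
  linear_combination 3 * hk - y * hl

include hp in
lemma bad_unique (hp5 : 5 ≤ p) (t' y y' : ℤ)
    (h1 : (p : ℤ) ^ 2 ∣ y ^ 3 + t * ((n + 1) * y ^ 2 - (n + 2) * y + 1))
    (h2 : (p : ℤ) ∣ 3 * y ^ 2 + t * (2 * (n + 1) * y - (n + 2)))
    (h1' : (p : ℤ) ^ 2 ∣ y' ^ 3 + t' * ((n + 1) * y' ^ 2 - (n + 2) * y' + 1))
    (h3 : (p : ℤ) ∣ (n + 1) * y' ^ 2 - 2 * (n + 2) * y' + 3) (hyy : (p : ℤ) ∣ y' - y) :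
    (p : ℤ) ^ 2 ∣ t - t' := by
  have hpp : Prime (p : ℤ) := Nat.prime_iff_prime_int.mp hp
  have hg : ¬ (p : ℤ) ∣ (n + 1) * y' ^ 2 - (n + 2) * y' + 1 := by
    intro hg
    have h4 : (p : ℤ) ∣ y' ^ 3 + t' * ((n + 1) * y' ^ 2 - (n + 2) * y' + 1) :=
      (dvd_pow_self _ (by norm_num)).trans h1'
    have hy : (p : ℤ) ∣ y' := hpp.dvd_of_dvd_pow ((dvd_add_left (hg.mul_left _)).mp h4)
    have h5 : (p : ℤ) ∣ 3 := by
      obtain ⟨k, hk⟩ := hy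
      obtain ⟨l, hl⟩ := h3
      exact ⟨l - (n + 1) * y' * k + 2 * (n + 2) * k, by
        linear_combination hl - ((n + 1) * y' - 2 * (n + 2)) * hk⟩
    have := Int.le_of_dvd (by norm_num) h5
    omega
  have h6 : (p : ℤ) ^ 2 ∣ y' ^ 3 + t * ((n + 1) * y' ^ 2 - (n + 2) * y' + 1) := by
    obtain ⟨k, hk⟩ := h1
    obtain ⟨l, hl⟩ := h2
    obtain ⟨d, hd⟩ := hyy
    obtain rfl : y' = y + p * d := by linear_combination hd
    refine ⟨k + d * l + d ^ 2 * (3 * y + p * d + t * (n + 1)), ?_⟩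
    linear_combination hk + p * d * hl
  have h7 : (p : ℤ) ^ 2 ∣ (t - t') * ((n + 1) * y' ^ 2 - (n + 2) * y' + 1) := by
    have e : (t - t') * ((n + 1) * y' ^ 2 - (n + 2) * y' + 1) =
      (y' ^ 3 + t * ((n + 1) * y' ^ 2 - (n + 2) * y' + 1)) -
      (y' ^ 3 + t' * ((n + 1) * y' ^ 2 - (n + 2) * y' + 1)) := by ring
    rw [e]
    exact dvd_sub h6 h1'
  exact (IsCoprime.pow_left (hpp.coprime_iff_not_dvd.mpr hg)).dvd_of_dvd_mul_right h7

include hp in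
lemma bad_le (hn : 1 ≤ n) (ht : 7 ≤ t) (h : badAt n t p) : (p : ℤ) ≤ 5 * n ^ 2 * t := by
  have hpp : Prime (p : ℤ) := Nat.prime_iff_prime_int.mp hp
  have hn2 : 1 ≤ n ^ 2 := by nlinarith
  by_cases hpt : (p : ℤ) ∣ t
  · have := Int.le_of_dvd (by linarith) hpt
    nlinarith
  obtain ⟨y, ⟨k, hk⟩, ⟨l, hl⟩⟩ := h
  obtain ⟨A, hA⟩ : ∃ A : ℤ, A = 3 * y + t * (n + 1) := ⟨_, rfl⟩
  have hQ : (p : ℤ) ^ 2 ∣ t ^ 2 *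
      (n ^ 2 * (n + 1) ^ 2 * t ^ 2 + 2 * (2 * n + 1) * (n + 2) * (n - 1) * t - 27) := by
    have e : t ^ 2 *
      (n ^ 2 * (n + 1) ^ 2 * t ^ 2 + 2 * (2 * n + 1) * (n + 2) * (n - 1) * t - 27) =
      A ^ 2 * (p * l) ^ 2 - 4 * (p * l) ^ 3 - 4 * A ^ 3 * (p ^ 2 * k) - 27 * (p ^ 2 * k) ^ 2
        + 18 * A * (p * l) * (p ^ 2 * k) := by
      rw [← hk, ← hl, hA]; ring
    rw [e]
    exact ⟨A ^ 2 * l ^ 2 - 4 * p * l ^ 3 - 4 * A ^ 3 * k - 27 * p ^ 2 * k ^ 2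
      + 18 * A * p * l * k, by ring⟩
  have hQ' := (IsCoprime.pow_left (m := 2)
    (IsCoprime.pow_right (n := 2) (hpp.coprime_iff_not_dvd.mpr hpt))).dvd_of_dvd_mul_left hQ
  have hn1 : 0 ≤ n - 1 := by linarith
  have hpos : 0 < n ^ 2 * (n + 1) ^ 2 * t ^ 2 + 2 * (2 * n + 1) * (n + 2) * (n - 1) * t - 27 := by
    have h1 : 0 ≤ 2 * (2 * n + 1) * (n + 2) * (n - 1) * t := by positivity
    have h2 : 4 ≤ (n + 1) ^ 2 := by nlinarith
    have h3 : 49 ≤ t ^ 2 := by nlinarith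
    have h4 : 4 ≤ n ^ 2 * (n + 1) ^ 2 := by nlinarith
    nlinarith
  have hle := Int.le_of_dvd hpos hQ'
  have hup : n ^ 2 * (n + 1) ^ 2 * t ^ 2 + 2 * (2 * n + 1) * (n + 2) * (n - 1) * t - 27 ≤
      (5 * n ^ 2 * t) ^ 2 := by
    have h1 : (n + 1) ^ 2 ≤ 4 * n ^ 2 := by nlinarith
    have h2 : n ^ 2 * (n + 1) ^ 2 * t ^ 2 ≤ n ^ 2 * (4 * n ^ 2) * t ^ 2 := by gcongr
    have h3 : 2 * (2 * n + 1) * (n + 2) * (n - 1) * t ≤ 2 * (3 * n) * (3 * n) * n * t ^ 2 := by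
      have : t ≤ t ^ 2 := by nlinarith
      gcongr <;> linarith
    have h4 : n ^ 3 ≤ n ^ 4 := by
      have : 0 ≤ n ^ 3 := by positivity
      nlinarith
    have h5 : n ^ 3 * t ^ 2 ≤ n ^ 4 * t ^ 2 := by gcongr
    have h6 : 0 ≤ n ^ 4 * t ^ 2 := by positivity
    nlinarith
  have : (p : ℤ) ^ 2 ≤ (5 * n ^ 2 * t) ^ 2 := hle.trans hup
  exact le_of_sq_le_sq this (by positivity)

end Bad

lemma card_le_of_cong (A : Finset ℕ) (S m : ℕ) (hA : ∀ x ∈ A, x < S)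
    (hc : ∀ x ∈ A, ∀ y ∈ A, x % m = y % m) : A.card ≤ S / m + 1 := by
  have : A.card ≤ (Finset.range (S / m + 1)).card := by
    apply Finset.card_le_card_of_injOn (fun x => x / m)
    · intro x hx
      simp only [Finset.coe_range, Set.mem_Iio]
      exact Nat.lt_succ_of_le (Nat.div_le_div_right (hA x hx).le)
    · intro x hx y hy hxy
      have h1 := hc x hx y hy
      have h2 := Nat.div_add_mod x m
      have h3 := Nat.div_add_mod y m
      simp only at hxy
      rw [← h2, ← h3, hxy, h1]
  simpa using this

open scoped Classical in
lemma bad_count (j p S : ℕ) (hp : p.Prime) (hp5 : 5 ≤ p) :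
    ((Finset.range S).filter (fun s : ℕ => badAt (12 * j + 1) (12 * s + 7) p)).card ≤
      (S / p ^ 2 + 1) * 3 := by
  have : Fact p.Prime := ⟨hp⟩
  set A := (Finset.range S).filter (fun s : ℕ => badAt (12 * j + 1) (12 * s + 7) p) with hA
  let y : ℕ → ℤ := fun s => if h : badAt (12 * j + 1) (12 * s + 7) p then h.choose else 0
  have hy : ∀ s ∈ A, (p : ℤ) ^ 2 ∣ (y s) ^ 3 + (12 * s + 7) *
      ((12 * j + 1 + 1) * (y s) ^ 2 - (12 * j + 1 + 2) * (y s) + 1) ∧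
      (p : ℤ) ∣ 3 * (y s) ^ 2 + (12 * s + 7) * (2 * (12 * j + 1 + 1) * (y s) - (12 * j + 1 + 2)) := by
    intro s hs
    have h := (Finset.mem_filter.mp hs).2
    simp only [y, dif_pos h]
    exact h.choose_spec
  let q : (ZMod p)[X] := C ((12 * j + 1 + 1 : ℤ) : ZMod p) * X ^ 2 -
    C ((2 * (12 * j + 1 + 2) : ℤ) : ZMod p) * X + C 3
  have h3 : (3 : ZMod p) ≠ 0 := by
    intro h
    have : ((3 : ℕ) : ZMod p) = 0 := by exact_mod_cast h
    rw [ZMod.natCast_eq_zero_iff] at this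
    have := Nat.le_of_dvd (by norm_num) this
    omega
  have hq0 : q ≠ 0 := by
    intro h
    have := congrArg (fun r => coeff r 0) h
    simp [q] at this
    exact h3 this
  have hqd : q.natDegree ≤ 2 := by
    simp only [q]; compute_degree
  let T : Finset (Option (ZMod p)) := Finset.insertNone q.roots.toFinset
  have hT : T.card ≤ 3 := by
    simp only [T, Finset.card_insertNone]
    have h1 := Multiset.toFinset_card_le q.roots
    have h2 := card_roots' q
    omega
  let label : ℕ → Option (ZMod p) := fun s =>
    if (p : ℤ) ∣ (12 * s + 7 : ℤ) then none else some ((y s : ℤ) : ZMod p)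
  have hcop : IsCoprime ((p : ℤ) ^ 2) 12 := by
    apply IsCoprime.pow_left
    have h1 : Nat.Coprime p 12 := by
      rw [Nat.Prime.coprime_iff_not_dvd hp]
      intro hd
      have h4 : p ∣ 2 * 2 * 3 := hd
      rcases (Nat.Prime.dvd_mul hp).mp h4 with h5 | h5
      · rcases (Nat.Prime.dvd_mul hp).mp h5 with h6 | h6 <;>
          have := Nat.le_of_dvd (by norm_num) h6 <;> omega
      · have := Nat.le_of_dvd (by norm_num) h5
        omega
    exact_mod_cast Nat.isCoprime_iff_coprime.mpr h1
  have hmain := Finset.card_le_mul_card_image_of_maps_to (s := A) (t := T) (f := label) (by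
      intro s hs
      simp only [label]
      split_ifs with h
      · simp [T]
      · have h1 := bad_root _ _ p hp (y s) (hy s hs).1 (hy s hs).2 h
        simp only [T, Finset.some_mem_insertNone, Multiset.mem_toFinset]
        rw [mem_roots hq0, IsRoot.def]
        rw [← ZMod.intCast_zmod_eq_zero_iff_dvd] at h1
        simp only [q, eval_add, eval_sub, eval_mul, eval_C, eval_X, eval_pow]
        rw [← h1]
        push_cast
        ring) (S / p ^ 2 + 1) (by
      intro l hl
      apply card_le_of_cong _ _ _
      · intro x hx
        exact Finset.mem_range.mp (Finset.mem_filter.mp (Finset.mem_filter.mp hx).1).1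
      · intro x hx x' hx'
        obtain ⟨hxA, hxl⟩ := Finset.mem_filter.mp hx
        obtain ⟨hxA', hxl'⟩ := Finset.mem_filter.mp hx'
        have hll : label x = label x' := hxl.trans hxl'.symm
        have hd : (p : ℤ) ^ 2 ∣ (12 * x + 7 : ℤ) - (12 * x' + 7 : ℤ) := by
          simp only [label] at hll
          split_ifs at hll with e1 e2 e2
          · exact dvd_sub (bad_dvd_t _ _ p hp (Finset.mem_filter.mp hxA).2 e1)
              (bad_dvd_t _ _ p hp (Finset.mem_filter.mp hxA').2 e2)
          · have hyy : ((y x' : ℤ) : ZMod p) = ((y x : ℤ) : ZMod p) := (Option.some.inj hll).symm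
            have hyy' : (p : ℤ) ∣ y x' - y x := by
              rw [← ZMod.intCast_zmod_eq_zero_iff_dvd]
              push_cast
              rw [hyy, sub_self]
            exact bad_unique _ _ p hp hp5 _ (y x) (y x') (hy x hxA).1 (hy x hxA).2 (hy x' hxA').1
              (bad_root _ _ p hp (y x') (hy x' hxA').1 (hy x' hxA').2 e2) hyy'
        have hd2 : (p : ℤ) ^ 2 ∣ 12 * ((x : ℤ) - x') := by
          convert hd using 1; ring
        have hd3 := hcop.dvd_of_dvd_mul_left hd2
        have h5 : (x' : ℤ) ≡ x [ZMOD ((p ^ 2 : ℕ) : ℤ)] := by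
          rw [Int.modEq_iff_dvd]; exact_mod_cast hd3
        exact ((Int.natCast_modEq_iff).mp h5).symm)
  exact hmain.trans (Nat.mul_le_mul_left _ hT)


lemma pi_small (c : ℕ) (hc : 0 < c) :
    ∀ᶠ S : ℕ in atTop, 3 * (Nat.primeCounting (c * S) : ℝ) ≤ S / 8 := by
  have h1 := Chebyshev.eventually_primeCounting_le (ε := 1) one_pos
  have hlim : Tendsto (fun S : ℕ => (c : ℝ) * (S : ℝ)) atTop atTop :=
    tendsto_natCast_atTop_atTop.const_mul_atTop (by exact_mod_cast hc)
  have h2 := hlim.eventually h1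
  have h3 := (Real.tendsto_log_atTop.comp hlim).eventually
    (eventually_ge_atTop (24 * (Real.log 4 + 1) * c))
  filter_upwards [h2, h3, eventually_gt_atTop 0] with S h2 h3 hS
  have hc' : (0:ℝ) < c := by exact_mod_cast hc
  have hS' : (0:ℝ) < S := by exact_mod_cast hS
  have e : ⌊(c : ℝ) * S⌋₊ = c * S := by
    rw [← Nat.cast_mul, Nat.floor_natCast]
  rw [e] at h2
  simp only [Function.comp] at h3
  have hl4 : 0 < Real.log 4 := Real.log_pos (by norm_num)
  have hlpos : 0 < Real.log (c * S) := lt_of_lt_of_le (by positivity) h3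
  rw [le_div_iff₀ hlpos] at h2
  have h4 : (Nat.primeCounting (c * S) : ℝ) * (24 * (Real.log 4 + 1) * c) ≤
      (Real.log 4 + 1) * (c * S) := le_trans (by gcongr) h2
  have h5 : ((Real.log 4 + 1) * c) * (24 * (Nat.primeCounting (c * S) : ℝ)) ≤
      ((Real.log 4 + 1) * c) * S := by linarith
  have h6 := le_of_mul_le_mul_left h5 (by positivity)
  linarith

open scoped Classical in
lemma good_count (j : ℕ) : ∀ᶠ S : ℕ in atTop, (S : ℝ) / 8 ≤
    ((Finset.range S).filter
      (fun s : ℕ => ∀ p : ℕ, p.Prime → ¬ badAt (12 * j + 1) (12 * s + 7) p)).card := by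
  set c : ℕ := 60 * (12 * j + 1) ^ 2 with hc
  filter_upwards [pi_small c (by positivity), eventually_gt_atTop 0] with S hpi hS
  set P := (Finset.Icc 5 (c * S)).filter Nat.Prime with hP
  set G := (Finset.range S).filter
      (fun s : ℕ => ∀ p : ℕ, p.Prime → ¬ badAt (12 * j + 1) (12 * s + 7) p) with hG
  have hcover : Finset.range S ⊆ G ∪ P.biUnion
      (fun p => (Finset.range S).filter (fun s : ℕ => badAt (12 * j + 1) (12 * s + 7) p)) := by
    intro s hs
    by_cases hg : ∀ p : ℕ, p.Prime → ¬ badAt (12 * j + 1) (12 * s + 7) p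
    · exact Finset.mem_union_left _ (Finset.mem_filter.mpr ⟨hs, hg⟩)
    · push Not at hg
      obtain ⟨p, hp, hb⟩ := hg
      apply Finset.mem_union_right
      rw [Finset.mem_biUnion]
      refine ⟨p, ?_, Finset.mem_filter.mpr ⟨hs, hb⟩⟩
      rw [hP, Finset.mem_filter, Finset.mem_Icc]
      refine ⟨⟨badAt_ge j s p hp hb, ?_⟩, hp⟩
      have h1 := bad_le _ _ p hp (by omega) (by omega) hb
      have h2 : s + 1 ≤ S := Finset.mem_range.mp hs
      have h3 : (12 * s + 7 : ℤ) ≤ 12 * S := by omega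
      have h4 : (p : ℤ) ≤ 5 * (12 * j + 1) ^ 2 * (12 * S) := h1.trans (by gcongr)
      zify
      rw [hc]
      push_cast
      linarith
  have h1 := Finset.card_le_card hcover
  rw [Finset.card_range] at h1
  have h2 : S ≤ G.card + ∑ p ∈ P, (S / p ^ 2 + 1) * 3 := by
    refine h1.trans ((Finset.card_union_le _ _).trans ?_)
    gcongr
    refine Finset.card_biUnion_le.trans (Finset.sum_le_sum ?_)
    intro p hp
    rw [hP, Finset.mem_filter, Finset.mem_Icc] at hp
    exact bad_count j p S hp.2 hp.1.1
  have h3 : (S : ℝ) ≤ G.card + ∑ p ∈ P, ((S : ℝ) * ((p : ℝ) ^ 2)⁻¹ + 1) * 3 := by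
    have h4 : (S : ℝ) ≤ ((G.card + ∑ p ∈ P, (S / p ^ 2 + 1) * 3 : ℕ) : ℝ) := by exact_mod_cast h2
    refine h4.trans ?_
    push_cast
    gcongr with p hp
    have := Nat.cast_div_le (α := ℝ) (m := S) (n := p ^ 2)
    rw [← div_eq_mul_inv]
    exact_mod_cast this
  rw [← Finset.sum_mul, Finset.sum_add_distrib, ← Finset.mul_sum] at h3
  have h5 : ∑ p ∈ P, ((p : ℝ) ^ 2)⁻¹ ≤ 1 / 4 := by
    have hcS : 4 ≤ c * S := by
      have : 1 ≤ (12 * j + 1) ^ 2 := Nat.one_le_pow _ _ (by omega)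
      nlinarith
    have h6 := sum_Ioc_inv_sq_le_sub (α := ℝ) (k := 4) (n := c * S) (by norm_num) hcS
    have h7 : ∑ p ∈ P, ((p : ℝ) ^ 2)⁻¹ ≤ ∑ p ∈ Finset.Ioc 4 (c * S), ((p : ℝ) ^ 2)⁻¹ := by
      apply Finset.sum_le_sum_of_subset_of_nonneg
      · intro p hp
        rw [hP, Finset.mem_filter, Finset.mem_Icc] at hp
        rw [Finset.mem_Ioc]
        exact ⟨by omega, hp.1.2⟩
      · intros; positivity
    have h8 : (0:ℝ) ≤ ((c * S : ℕ) : ℝ)⁻¹ := by positivity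
    norm_num at h6 h8 ⊢
    linarith
  have h6 : ∑ p ∈ P, (1 : ℝ) ≤ Nat.primeCounting (c * S) := by
    rw [Finset.sum_const, nsmul_eq_mul, mul_one]
    have : P.card ≤ Nat.primeCounting (c * S) := by
      rw [Nat.primeCounting, Nat.primeCounting', Nat.count_eq_card_filter_range]
      apply Finset.card_le_card
      intro p hp
      rw [hP, Finset.mem_filter, Finset.mem_Icc] at hp
      rw [Finset.mem_filter, Finset.mem_range]
      exact ⟨by omega, hp.2⟩
    exact_mod_cast this
  have hS' : (0:ℝ) < S := by exact_mod_cast hS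
  have h7 : (S : ℝ) * ∑ p ∈ P, ((p : ℝ) ^ 2)⁻¹ ≤ S * (1 / 4) := by gcongr
  linarith

lemma fam_mem (j s : ℕ) (h : ∀ p : ℕ, p.Prime → ¬ badAt (12 * j + 1) (12 * s + 7) p) :
    InBFam (3 + (12 * j + 2) * (12 * s + 7), 3 + (12 * j + 1) * (12 * s + 7)) := by
  obtain ⟨a, ha⟩ : ∃ a : ℤ, a = 3 + (12 * j + 2) * (12 * s + 7) := ⟨_, rfl⟩
  obtain ⟨b, hb⟩ : ∃ b : ℤ, b = 3 + (12 * j + 1) * (12 * s + 7) := ⟨_, rfl⟩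
  rw [← ha, ← hb]
  have ha0 : 0 < a := by rw [ha]; positivity
  have hb0 : 0 < b := by rw [hb]; positivity
  have hab : a - b = 12 * s + 7 := by rw [ha, hb]; ring
  have hirr : Irreducible (cubicPoly a b) := by
    rw [(cubicPoly_monic a b).irreducible_iff_roots_eq_zero_of_degree_le_three
      (by rw [cubicPoly_natDegree]; norm_num) (by rw [cubicPoly_natDegree])]
    rw [Multiset.eq_zero_iff_forall_notMem]
    intro q hq
    rw [mem_roots (cubicPoly_monic a b).ne_zero, IsRoot.def] at hq
    unfold cubicPoly at hq
    simp only [eval_add, eval_mul, eval_C, eval_X, eval_pow, eval_one] at hq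
    have hqi : IsIntegral ℤ q := by
      refine ⟨X ^ 3 + C a * X ^ 2 + C b * X + 1, by monicity!, ?_⟩
      rw [← aeval_def]
      simpa using hq
    obtain ⟨r, rfl⟩ := int_of_rat_integral (K := ℚ) q (by simpa using hqi)
    have hr : r ^ 3 + a * r ^ 2 + b * r + 1 = 0 := by exact_mod_cast hq
    have hu : r * (-(r ^ 2 + a * r + b)) = 1 := by linear_combination -hr
    rcases Int.isUnit_iff.mp (IsUnit.of_mul_eq_one _ hu) with rfl | rfl
    · linarith
    · omega
  refine ⟨ha0, hb0, Or.inr (Or.inl ?_), hirr, maximal_of a b hirr ?_⟩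
  · have h1 : a = 4 * (36 * j * s + 21 * j + 6 * s + 4) + 1 := by rw [ha]; ring
    have h2 : b = 4 * (36 * j * s + 21 * j + 3 * s + 2) + 2 := by rw [hb]; ring
    simp only [Prod.mk.injEq]
    constructor
    · rw [h1]; omega
    · rw [h2]; omega
  · rintro p hp r ⟨h1, h2⟩
    refine h p hp ⟨r + 1, ?_, ?_⟩
    · convert h1 using 1
      rw [ha, hb]; ring
    · convert h2 using 1
      rw [ha, hb]; ring

open scoped Classical in
lemma NB_ge (J : ℕ) (X : ℝ) (hX : 0 ≤ X) :
    ∑ j ∈ Finset.range J, ((Finset.range ⌊X / (12 * (12 * j + 2))⌋₊).filter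
      (fun s : ℕ => ∀ p : ℕ, p.Prime → ¬ badAt (12 * j + 1) (12 * s + 7) p)).card ≤ NB X := by
  rw [← Finset.card_sigma]
  unfold NB
  rw [Nat.card_coe_set_eq, ← Set.ncard_coe_finset]
  refine Set.ncard_le_ncard_of_injOn
    (fun q : (_ : ℕ) × ℕ => ((3 + (12 * q.1 + 2) * (12 * q.2 + 7) : ℤ),
      (3 + (12 * q.1 + 1) * (12 * q.2 + 7) : ℤ))) ?_ ?_ (fam_finite X)
  · rintro ⟨j, s⟩ hq
    rw [Finset.mem_coe, Finset.mem_sigma, Finset.mem_filter, Finset.mem_range, Finset.mem_range] at hq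
    obtain ⟨-, hs, hg⟩ := hq
    simp only at hs hg
    refine ⟨fam_mem j s hg, ?_⟩
    have h1 : ((s + 1 : ℕ) : ℝ) ≤ X / (12 * (12 * j + 2)) := by
      rw [← Nat.le_floor_iff (by positivity)]; exact hs
    rw [le_div_iff₀ (by positivity)] at h1
    push_cast at h1
    have hj : (0:ℝ) ≤ j := by positivity
    have hs0 : (0:ℝ) ≤ s := by positivity
    rw [max_le_iff]
    push_cast
    constructor <;> nlinarith
  · rintro ⟨j, s⟩ - ⟨j', s'⟩ - h
    simp only [Prod.mk.injEq] at h
    obtain ⟨h1, h2⟩ := h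
    have hs : s = s' := by
      have : (12 * s + 7 : ℤ) = 12 * s' + 7 := by linear_combination h1 - h2
      omega
    subst hs
    have hj : j = j' := by
      have h3 : (12 * s + 7 : ℤ) ≠ 0 := by positivity
      have h4 : (12 * j + 1 : ℤ) = 12 * j' + 1 := by
        apply mul_right_cancel₀ h3; linarith
      omega
    subst hj
    rfl

lemma NB_lower (J : ℕ) : ∀ᶠ X : ℝ in atTop,
    X * ((1 / 2304) * ∑ j ∈ Finset.range J, 1 / ((j : ℝ) + 1)) ≤ NB X := by
  classical
  have hev : ∀ᶠ X : ℝ in atTop, ∀ j ∈ Finset.range J, X * ((1 / 2304) * (1 / ((j : ℝ) + 1))) ≤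
      (((Finset.range ⌊X / (12 * (12 * (j : ℝ) + 2))⌋₊).filter
      (fun s : ℕ => ∀ p : ℕ, p.Prime → ¬ badAt (12 * j + 1) (12 * s + 7) p)).card : ℝ) := by
    rw [Filter.eventually_all_finset]
    intro j _
    have hpos : (0:ℝ) < 12 * (12 * (j : ℝ) + 2) := by positivity
    have hlim : Tendsto (fun X : ℝ => ⌊X / (12 * (12 * (j : ℝ) + 2))⌋₊) atTop atTop :=
      tendsto_nat_floor_atTop.comp (tendsto_id.atTop_div_const hpos)
    filter_upwards [hlim.eventually (good_count j),
      eventually_ge_atTop (2 * (12 * (12 * (j : ℝ) + 2)))] with X h1 h2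
    refine le_trans ?_ h1
    have h3 : X / (12 * (12 * (j : ℝ) + 2)) < ⌊X / (12 * (12 * (j : ℝ) + 2))⌋₊ + 1 :=
      Nat.lt_floor_add_one _
    have h4 : 2 ≤ X / (12 * (12 * (j : ℝ) + 2)) := by rwa [le_div_iff₀ hpos]
    have h5 : X / (144 * ((j : ℝ) + 1)) ≤ X / (12 * (12 * (j : ℝ) + 2)) := by
      have : 0 ≤ X := by linarith
      exact div_le_div_of_nonneg_left this hpos (by linarith)
    have h6 : X * ((1 / 2304) * (1 / ((j : ℝ) + 1))) = (X / (144 * ((j : ℝ) + 1))) / 16 := by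
      field_simp; ring
    rw [h6]
    linarith
  filter_upwards [hev, eventually_ge_atTop 0] with X h1 hX
  have h2 := NB_ge J X hX
  have h3 := Finset.sum_le_sum h1
  rw [Finset.mul_sum, Finset.mul_sum]
  refine h3.trans ?_
  have h4 := Nat.cast_le (α := ℝ).mpr h2
  rw [Nat.cast_sum] at h4
  exact h4

/-- The proportion of members of `+B²₁₁`, ordered by symmetric height, whose class
group has trivial 2-torsion tends to `0`: all but a density-zero proportion satisfy
`|Cl[2]| ≥ 2`. -/
theorem proportion_trivial_cl2_tendsto_zero :
    Filter.Tendsto (fun X : ℝ => (EB X : ℝ) / (NB X : ℝ)) Filter.atTop (nhds 0) := by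
  have hNB : Tendsto (fun X : ℝ => (NB X : ℝ) / X) atTop atTop := by
    rw [tendsto_atTop]
    intro M
    have hH := Real.tendsto_sum_range_one_div_nat_succ_atTop
    obtain ⟨J, hJ⟩ := (hH.eventually (eventually_ge_atTop (2304 * M))).exists
    filter_upwards [NB_lower J, eventually_gt_atTop 0] with X h1 hX
    rw [le_div_iff₀ hX]
    refine le_trans ?_ h1
    rw [mul_comm]
    gcongr
    linarith
  have hlim : Tendsto (fun X : ℝ => 98 / ((NB X : ℝ) / X)) atTop (nhds 0) :=
    hNB.const_div_atTop 98
  refine squeeze_zero' (Eventually.of_forall fun X => by positivity) ?_ hlim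
  filter_upwards [eventually_ge_atTop 1] with X hX
  have h1 := EB_le X hX
  rw [div_div_eq_mul_div]
  gcongr
end
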